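/- Let β⃗ be sub-critical. Then the spectral gap γ of the Glauber dynamics generator is of order n^{-2}: there exist constants c, C > 0 (depending only on β⃗ and G_1,…,G_s) such that for all sufficiently large n, c n^{-2} ≤ γ ≤ C n^{-2}. In particular the Poincaré inequality holds: for all sufficiently large n and every f : 𝒢_n → ℝ, Var_π(f) ≤ C n² ℰ(f,f). -/

import Mathlib

open Finset MeasureTheory Filter
open scoped ENNReal NNReal

namespace ERGM

/-- The set of edges of the complete graph on `Fin n`: non-diagonal unordered pairs. -/
abbrev EdgeSet (n : ℕ) : Type := {p : Sym2 (Fin n) // ¬ p.IsDiag}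

/-- A configuration (graph on `n` vertices): an assignment of `true/false` to each edge. -/
abbrev Config (n : ℕ) : Type := EdgeSet n → Bool

/-- The value of the configuration `x` on the (unordered) pair `{i,j}`; `false` for `i = j`. -/
noncomputable def edgeVal {n : ℕ} (x : Config n) (i j : Fin n) : Bool :=
  if h : (s(i, j) : Sym2 (Fin n)).IsDiag then false else x ⟨s(i, j), h⟩

/-- Real-valued indicator of presence of the edge `{i,j}` in `x`. -/
noncomputable def edgeInd {n : ℕ} (x : Config n) (i j : Fin n) : ℝ :=
  if edgeVal x i j = true then 1 else 0

open scoped Classical in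
/-- Subgraph counting number `N_G(x)`: the number of copies of `G` in `x` (times the
number of automorphisms), i.e. the sum over injective `ψ` of the product of edge
indicators (each edge indicator is idempotent, so counting ordered adjacent pairs
yields the same value as counting edges). -/
noncomputable def NG {n m : ℕ} (G : SimpleGraph (Fin m)) (x : Config n) : ℝ :=
  ∑ ψ : Fin m ↪ Fin n, ∏ a : Fin m, ∏ b : Fin m,
    if G.Adj a b then edgeInd x (ψ a) (ψ b) else 1

/-- The Hamiltonian `H(x) = Σ_i β_i N_{G_i}(x) / n^{|V_i|-2}`. -/
noncomputable def Hamiltonian {n s : ℕ} (V : Fin s → ℕ)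
    (G : ∀ i, SimpleGraph (Fin (V i))) (β : Fin s → ℝ) (x : Config n) : ℝ :=
  ∑ i, β i * NG (G i) x / (n : ℝ) ^ (V i - 2)

/-- The ERGM probability mass function `π(x) ∝ exp(H(x))`. -/
noncomputable def ergmProb {n s : ℕ} (V : Fin s → ℕ)
    (G : ∀ i, SimpleGraph (Fin (V i))) (β : Fin s → ℝ) (x : Config n) : ℝ :=
  Real.exp (Hamiltonian V G β x) / ∑ y : Config n, Real.exp (Hamiltonian V G β y)

/-- Expectation of `f` with respect to the mass function `w`. -/
noncomputable def expect {n : ℕ} (w : Config n → ℝ) (f : Config n → ℝ) : ℝ :=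
  ∑ x : Config n, w x * f x

open scoped Classical in
/-- Probability of the event `A` with respect to the mass function `w`. -/
noncomputable def prob {n : ℕ} (w : Config n → ℝ) (A : Config n → Prop) : ℝ :=
  ∑ x : Config n, if A x then w x else 0

/-- The number of edges `|E(G)|` of a finite graph. -/
noncomputable def numEdges {m : ℕ} (G : SimpleGraph (Fin m)) : ℕ := G.edgeSet.ncard

/-- `Ψ_β(p) = Σ_i 2 β_i |E_i| p^{|E_i|-1}`. -/
noncomputable def Psi {s : ℕ} (V : Fin s → ℕ) (G : ∀ i, SimpleGraph (Fin (V i)))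
    (β : Fin s → ℝ) (p : ℝ) : ℝ :=
  ∑ i, 2 * β i * (numEdges (G i) : ℝ) * p ^ (numEdges (G i) - 1)

/-- `Φ(u) = e^u / (1 + e^u)`. -/
noncomputable def Phi (u : ℝ) : ℝ := Real.exp u / (1 + Real.exp u)

/-- `φ_β(p) = Φ(Ψ_β(p))`. -/
noncomputable def phiFn {s : ℕ} (V : Fin s → ℕ) (G : ∀ i, SimpleGraph (Fin (V i)))
    (β : Fin s → ℝ) : ℝ → ℝ := fun p => Phi (Psi V G β p)

/-- `β` is sub-critical (high temperature) with fixed point `p`: `p` is the unique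
solution of `φ_β(p) = p` and it satisfies `φ_β'(p) < 1`. -/
def Subcritical {s : ℕ} (V : Fin s → ℕ) (G : ∀ i, SimpleGraph (Fin (V i)))
    (β : Fin s → ℝ) (p : ℝ) : Prop :=
  phiFn V G β p = p ∧ (∀ q : ℝ, phiFn V G β q = q → q = p) ∧
    deriv (phiFn V G β) p < 1

/-- The discrete derivative `∂_e H(x) = H(x_{e+}) - H(x_{e-})`. -/
noncomputable def dHam {n s : ℕ} (V : Fin s → ℕ) (G : ∀ i, SimpleGraph (Fin (V i)))
    (β : Fin s → ℝ) (e : EdgeSet n) (x : Config n) : ℝ :=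
  Hamiltonian V G β (Function.update x e true) - Hamiltonian V G β (Function.update x e false)

/-- Real-valued indicator `X_e` of presence of edge `e`. -/
noncomputable def edgeX {n : ℕ} (e : EdgeSet n) (x : Config n) : ℝ := if x e = true then 1 else 0

/-- Two edges of `K_n` share a vertex. -/
def ShareVertex {n : ℕ} (e f : EdgeSet n) : Prop := ∃ v : Fin n, v ∈ e.1 ∧ v ∈ f.1

/-- The rate `c(x,e)`: the probability that the Glauber update at edge `e` flips the
current state `x` to `x^e`. -/
noncomputable def flipRate {n s : ℕ} (V : Fin s → ℕ) (G : ∀ i, SimpleGraph (Fin (V i)))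
    (β : Fin s → ℝ) (x : Config n) (e : EdgeSet n) : ℝ :=
  if x e = true then 1 - Phi (dHam V G β e x) else Phi (dHam V G β e x)

/-- The Dirichlet form `ℰ(f,f) = (1/M) Σ_x Σ_e c(x,e) (f(x^e) - f(x))² π(x)`. -/
noncomputable def dirichlet {n s : ℕ} (V : Fin s → ℕ) (G : ∀ i, SimpleGraph (Fin (V i)))
    (β : Fin s → ℝ) (f : Config n → ℝ) : ℝ :=
  (Fintype.card (EdgeSet n) : ℝ)⁻¹ *
    ∑ x : Config n, ∑ e : EdgeSet n,
      flipRate V G β x e * (f (Function.update x e (!(x e))) - f x) ^ 2 * ergmProb V G β x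

/-- Variance of `f` under the mass function `w`. -/
noncomputable def variance {n : ℕ} (w : Config n → ℝ) (f : Config n → ℝ) : ℝ :=
  expect w (fun x => (f x - expect w f) ^ 2)

/-- The spectral gap `γ = inf {ℰ(f,f) : E_π f = 0, E_π f² = 1}`. -/
noncomputable def specGap (n : ℕ) {s : ℕ} (V : Fin s → ℕ) (G : ∀ i, SimpleGraph (Fin (V i)))
    (β : Fin s → ℝ) : ℝ :=
  sInf {E : ℝ | ∃ f : Config n → ℝ, expect (ergmProb V G β) f = 0 ∧
    expect (ergmProb V G β) (fun x => (f x) ^ 2) = 1 ∧ E = dirichlet V G β f}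

section HeatBath

theorem update_le_update_of_le {E : Type*} [DecidableEq E] {x y : E → Bool} (hxy : x ≤ y) (e : E) (b : Bool) :
    Function.update x e b ≤ Function.update y e b :=
  update_le_update_iff.mpr ⟨le_rfl, fun j _ => hxy j⟩

theorem update_false_le_update_true {E : Type*} [DecidableEq E] (x : E → Bool) (e : E) :
    Function.update x e false ≤ Function.update x e true :=
  update_le_update_iff.mpr ⟨Bool.false_le _, fun _ _ => le_rfl⟩

theorem card_inv_mul_card {E : Type*} [Fintype E] [Nonempty E] : (Fintype.card E : ℝ)⁻¹ * Fintype.card E = 1 :=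
  inv_mul_cancel₀ (Nat.cast_ne_zero.mpr Fintype.card_ne_zero)

theorem card_inv_le_one {E : Type*} [Fintype E] [Nonempty E] : (Fintype.card E : ℝ)⁻¹ ≤ 1 :=
  inv_le_one_of_one_le₀ (Nat.one_le_cast.mpr Fintype.card_pos)

variable {E : Type*} [Fintype E] [DecidableEq E]

/-- The random-scan heat-bath kernel on `E → Bool`: a uniformly random site `e` is refreshed,
becoming `true` with probability `a e x`. -/
noncomputable def glauber (a : E → (E → Bool) → ℝ) : Module.End ℝ ((E → Bool) → ℝ) where
  toFun f x := (Fintype.card E : ℝ)⁻¹ * ∑ e, (a e x * f (Function.update x e true) +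
    (1 - a e x) * f (Function.update x e false))
  map_add' f g := by
    funext x
    simp only [Pi.add_apply, ← mul_add, ← Finset.sum_add_distrib]
    congr 1
    exact Finset.sum_congr rfl fun e _ => by ring
  map_smul' c f := by
    funext x
    simp only [Pi.smul_apply, smul_eq_mul, RingHom.id_apply, Finset.mul_sum]
    exact Finset.sum_congr rfl fun e _ => by ring

theorem glauber_apply (a : E → (E → Bool) → ℝ) (f : (E → Bool) → ℝ) (x : E → Bool) :
    glauber a f x = (Fintype.card E : ℝ)⁻¹ * ∑ e, (a e x * f (Function.update x e true) +
      (1 - a e x) * f (Function.update x e false)) := rfl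

theorem glauber_pow_succ_apply (a : E → (E → Bool) → ℝ) (t : ℕ) (f : (E → Bool) → ℝ) :
    (glauber a ^ (t + 1)) f = (glauber a ^ t) (glauber a f) := by
  rw [pow_succ, Module.End.mul_apply]

theorem glauber_pow_succ_apply' (a : E → (E → Bool) → ℝ) (t : ℕ) (f : (E → Bool) → ℝ) :
    (glauber a ^ (t + 1)) f = glauber a ((glauber a ^ t) f) := by
  rw [pow_succ', Module.End.mul_apply]

theorem glauber_pow_add_apply (a : E → (E → Bool) → ℝ) (s t : ℕ) (f : (E → Bool) → ℝ) :
    (glauber a ^ (s + t)) f = (glauber a ^ s) ((glauber a ^ t) f) := by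
  rw [pow_add, Module.End.mul_apply]

theorem glauber_const [Nonempty E] (a : E → (E → Bool) → ℝ) (c : ℝ) :
    glauber a (fun _ => c) = fun _ => c := by
  funext x
  have h : ∀ e, a e x * c + (1 - a e x) * c = c := fun e => by ring
  simp only [glauber_apply, h, Finset.sum_const, Finset.card_univ, nsmul_eq_mul]
  rw [← mul_assoc, card_inv_mul_card, one_mul]

theorem glauber_pow_const [Nonempty E] (a : E → (E → Bool) → ℝ) (c : ℝ) (t : ℕ) :
    (glauber a ^ t) (fun _ => c) = fun _ => c := by
  induction t with
  | zero => rfl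
  | succ t ih => rw [glauber_pow_succ_apply, glauber_const, ih]

theorem glauber_le {a : E → (E → Bool) → ℝ} (h0 : ∀ e x, 0 ≤ a e x) (h1 : ∀ e x, a e x ≤ 1)
    {f g : (E → Bool) → ℝ} (hfg : ∀ x, f x ≤ g x) (x : E → Bool) :
    glauber a f x ≤ glauber a g x := by
  rw [glauber_apply, glauber_apply]
  refine mul_le_mul_of_nonneg_left (Finset.sum_le_sum fun e _ => ?_) (by positivity)
  exact add_le_add (mul_le_mul_of_nonneg_left (hfg _) (h0 e x))
    (mul_le_mul_of_nonneg_left (hfg _) (sub_nonneg.mpr (h1 e x)))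

theorem glauber_pow_le {a : E → (E → Bool) → ℝ} (h0 : ∀ e x, 0 ≤ a e x)
    (h1 : ∀ e x, a e x ≤ 1) (t : ℕ) {f g : (E → Bool) → ℝ} (hfg : ∀ x, f x ≤ g x)
    (x : E → Bool) : (glauber a ^ t) f x ≤ (glauber a ^ t) g x := by
  induction t generalizing f g with
  | zero => exact hfg x
  | succ t ih =>
    rw [glauber_pow_succ_apply, glauber_pow_succ_apply]
    exact ih (glauber_le h0 h1 hfg)

theorem glauber_pow_le_const [Nonempty E] {a : E → (E → Bool) → ℝ} (h0 : ∀ e x, 0 ≤ a e x)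
    (h1 : ∀ e x, a e x ≤ 1) (t : ℕ) {f : (E → Bool) → ℝ} {c : ℝ} (hf : ∀ x, f x ≤ c)
    (x : E → Bool) : (glauber a ^ t) f x ≤ c := by
  have := glauber_pow_le h0 h1 t (g := fun _ => c) hf x
  rwa [glauber_pow_const] at this

theorem const_le_glauber_pow [Nonempty E] {a : E → (E → Bool) → ℝ} (h0 : ∀ e x, 0 ≤ a e x)
    (h1 : ∀ e x, a e x ≤ 1) (t : ℕ) {f : (E → Bool) → ℝ} {c : ℝ} (hf : ∀ x, c ≤ f x)
    (x : E → Bool) : c ≤ (glauber a ^ t) f x := by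
  have := glauber_pow_le h0 h1 t (f := fun _ => c) hf x
  rwa [glauber_pow_const] at this

theorem glauber_monotone {a : E → (E → Bool) → ℝ} (h0 : ∀ e x, 0 ≤ a e x)
    (h1 : ∀ e x, a e x ≤ 1) (ha : ∀ e, Monotone (a e)) {f : (E → Bool) → ℝ} (hf : Monotone f) :
    Monotone (glauber a f) := by
  intro x y hxy
  rw [glauber_apply, glauber_apply]
  refine mul_le_mul_of_nonneg_left (Finset.sum_le_sum fun e _ => ?_) (by positivity)
  have h2 := ha e hxy
  have h3 := hf (update_le_update_of_le hxy e true)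
  have h4 := hf (update_le_update_of_le hxy e false)
  have h5 := hf (update_false_le_update_true y e)
  nlinarith [h0 e x, h1 e x, mul_nonneg (h0 e x) (sub_nonneg.mpr h3),
    mul_nonneg (sub_nonneg.mpr (h1 e x)) (sub_nonneg.mpr h4),
    mul_nonneg (sub_nonneg.mpr h2) (sub_nonneg.mpr h5)]

theorem glauber_pow_monotone {a : E → (E → Bool) → ℝ} (h0 : ∀ e x, 0 ≤ a e x)
    (h1 : ∀ e x, a e x ≤ 1) (ha : ∀ e, Monotone (a e)) (t : ℕ) {f : (E → Bool) → ℝ}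
    (hf : Monotone f) : Monotone ((glauber a ^ t) f) := by
  induction t generalizing f with
  | zero => exact hf
  | succ t ih => rw [glauber_pow_succ_apply]; exact ih (glauber_monotone h0 h1 ha hf)

theorem glauber_pow_antitone {a : E → (E → Bool) → ℝ} (h0 : ∀ e x, 0 ≤ a e x)
    (h1 : ∀ e x, a e x ≤ 1) (ha : ∀ e, Monotone (a e)) (t : ℕ) {f : (E → Bool) → ℝ}
    (hf : Antitone f) : Antitone ((glauber a ^ t) f) := by
  have h : Monotone ((glauber a ^ t) (-f)) := glauber_pow_monotone h0 h1 ha t hf.neg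
  rw [map_neg] at h
  exact fun x y hxy => neg_le_neg_iff.mp (h hxy)

theorem glauber_le_of_rate_le {a b : E → (E → Bool) → ℝ} {x : E → Bool}
    (hab : ∀ e, a e x ≤ b e x) {f : (E → Bool) → ℝ} (hf : Monotone f) :
    glauber a f x ≤ glauber b f x := by
  rw [glauber_apply, glauber_apply]
  refine mul_le_mul_of_nonneg_left (Finset.sum_le_sum fun e _ => ?_) (by positivity)
  nlinarith [mul_nonneg (sub_nonneg.mpr (hab e))
    (sub_nonneg.mpr (hf (update_false_le_update_true x e)))]

theorem glauber_le_of_le_rate {a b : E → (E → Bool) → ℝ} {x : E → Bool}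
    (hab : ∀ e, b e x ≤ a e x) {f : (E → Bool) → ℝ} (hf : Antitone f) :
    glauber a f x ≤ glauber b f x := by
  have h : glauber b (-f) x ≤ glauber a (-f) x := glauber_le_of_rate_le hab hf.neg
  rw [map_neg, map_neg] at h
  exact neg_le_neg_iff.mp h

/-- Comparison of two heat-bath chains up to the time spent in the set `B` where the one-step
comparison fails. -/
theorem glauber_pow_le_add_sum [Nonempty E] {a b : E → (E → Bool) → ℝ}
    (ha0 : ∀ e x, 0 ≤ a e x) (ha1 : ∀ e x, a e x ≤ 1)
    (hb0 : ∀ e x, 0 ≤ b e x) (hb1 : ∀ e x, b e x ≤ 1)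
    {B : Set (E → Bool)} {g : (E → Bool) → ℝ} (hg0 : ∀ x, 0 ≤ g x) (hg1 : ∀ x, g x ≤ 1)
    (hB : ∀ t, ∀ x ∉ B, glauber a ((glauber b ^ t) g) x ≤ glauber b ((glauber b ^ t) g) x)
    (t : ℕ) (x : E → Bool) :
    (glauber a ^ t) g x ≤
      (glauber b ^ t) g x + ∑ s ∈ Finset.range t, (glauber a ^ s) (B.indicator 1) x := by
  induction t generalizing x with
  | zero => simp
  | succ t ih =>
    rw [glauber_pow_succ_apply']
    refine (glauber_le ha0 ha1 (g := (glauber b ^ t) g +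
      ∑ s ∈ Finset.range t, (glauber a ^ s) (B.indicator 1)) (fun y => ?_) x).trans ?_
    · simpa [Finset.sum_apply] using ih y
    · rw [map_add, map_sum, Finset.sum_range_succ', Pi.add_apply, Finset.sum_apply,
        glauber_pow_succ_apply']
      simp only [← glauber_pow_succ_apply']
      have : glauber a ((glauber b ^ t) g) x ≤
          glauber b ((glauber b ^ t) g) x + B.indicator 1 x := by
        by_cases hx : x ∈ B
        · have h1 : glauber a ((glauber b ^ t) g) x ≤ 1 := by
            have := glauber_pow_le_const ha0 ha1 1 (glauber_pow_le_const hb0 hb1 t hg1) x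
            rwa [pow_one] at this
          have h2 : 0 ≤ glauber b ((glauber b ^ t) g) x := by
            rw [← glauber_pow_succ_apply']
            exact const_le_glauber_pow hb0 hb1 _ hg0 x
          simp only [Set.indicator_of_mem hx, Pi.one_apply]
          linarith
        · rw [Set.indicator_of_notMem hx, add_zero]
          exact hB t x hx
      simp only [pow_zero, Module.End.one_apply]
      rw [glauber_pow_succ_apply']
      linarith

/-- A function on the cube is monotone if it increases along every edge of the cube. -/
theorem monotone_of_update {f : (E → Bool) → ℝ}
    (hf : ∀ x e, f (Function.update x e false) ≤ f (Function.update x e true)) :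
    Monotone f := by
  intro x y hxy
  have key : ∀ A : Finset E, f x ≤ f (fun e => if e ∈ A then y e else x e) := by
    intro A
    induction A using Finset.induction_on with
    | empty => simp
    | insert e A he ih =>
      refine ih.trans ?_
      set z : E → Bool := fun e => if e ∈ A then y e else x e with hz
      have h1 : (fun e' => if e' ∈ insert e A then y e' else x e') =
          Function.update z e (y e) := by
        funext e'
        by_cases h : e' = e
        · subst h; simp
        · simp [h, hz]
      have h2 : z = Function.update z e (x e) := by
        funext e'
        by_cases h : e' = e
        · subst h; simp [hz, he]
        · simp [h]
      rw [h1]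
      conv_lhs => rw [h2]
      have h3 := hxy e
      cases hx : x e <;> cases hy : y e
      · exact le_rfl
      · exact hf z e
      · rw [hx, hy] at h3; exact absurd (h3 rfl) (by simp)
      · exact le_rfl
  simpa using key Finset.univ

end HeatBath

section ConstantRate

variable {E : Type*} [DecidableEq E]

/-- The monomial `∏ e ∈ S, x e`, as a `0/1`-valued function on the cube. -/
noncomputable def mono (S : Finset E) (x : E → Bool) : ℝ :=
  if ∀ e ∈ S, x e = true then 1 else 0

omit [DecidableEq E] in
theorem mono_nonneg (S : Finset E) (x : E → Bool) : 0 ≤ mono S x := by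
  unfold mono; split_ifs <;> norm_num

omit [DecidableEq E] in
theorem mono_le_one (S : Finset E) (x : E → Bool) : mono S x ≤ 1 := by
  unfold mono; split_ifs <;> norm_num

omit [DecidableEq E] in
theorem mono_empty : mono (∅ : Finset E) = fun _ => 1 := by
  funext x; simp [mono]

omit [DecidableEq E] in
theorem mono_monotone (S : Finset E) : Monotone (mono S) := by
  intro x y hxy
  by_cases h : ∀ e ∈ S, x e = true
  · have h' : ∀ e ∈ S, y e = true := fun e he => by
      have := hxy e
      rw [h e he] at this
      exact this rfl
    unfold mono
    rw [if_pos h, if_pos h']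
  · simpa [mono, h] using mono_nonneg S y

theorem mono_update_true (S : Finset E) (x : E → Bool) (e : E) :
    mono S (Function.update x e true) = mono (S.erase e) x := by
  unfold mono
  congr 1
  simp only [Finset.mem_erase, eq_iff_iff]
  refine ⟨fun h f hf => ?_, fun h f hf => ?_⟩
  · simpa [hf.1] using h f hf.2
  · by_cases hfe : f = e
    · subst hfe; simp
    · simpa [hfe] using h f ⟨hfe, hf⟩

theorem mono_update_of_notMem {S : Finset E} {e : E} (he : e ∉ S) (x : E → Bool) (b : Bool) :
    mono S (Function.update x e b) = mono S x := by
  unfold mono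
  congr 1
  simp only [eq_iff_iff]
  refine forall₂_congr fun f hf => ?_
  rw [Function.update_of_ne (by rintro rfl; exact he hf)]

theorem mono_update_false_of_mem {S : Finset E} {e : E} (he : e ∈ S) (x : E → Bool) :
    mono S (Function.update x e false) = 0 := by
  unfold mono
  rw [if_neg]
  intro h
  simpa using h e he

theorem mono_update_sub (S : Finset E) (x : E → Bool) (e : E) :
    mono S (Function.update x e true) - mono S (Function.update x e false) =
      if e ∈ S then mono (S.erase e) x else 0 := by
  split_ifs with he
  · rw [mono_update_true, mono_update_false_of_mem he, sub_zero]
  · rw [mono_update_of_notMem he, mono_update_of_notMem he, sub_self]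

variable [Fintype E]

omit [DecidableEq E] in
theorem card_inv_mul_card_le_one [Nonempty E] (S : Finset E) :
    (Fintype.card E : ℝ)⁻¹ * #S ≤ 1 := by
  rw [← card_inv_mul_card (E := E)]
  exact mul_le_mul_of_nonneg_left (Nat.cast_le.mpr S.card_le_univ) (by positivity)

theorem glauber_const_mono [Nonempty E] (q : ℝ) (S : Finset E) :
    glauber (fun _ _ => q) (mono S) = (1 - (Fintype.card E : ℝ)⁻¹ * #S) • mono S +
      ((Fintype.card E : ℝ)⁻¹ * q) • ∑ e ∈ S, mono (S.erase e) := by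
  funext x
  have h : ∀ e : E, q * mono S (Function.update x e true) +
      (1 - q) * mono S (Function.update x e false) =
      mono S x + if e ∈ S then q * mono (S.erase e) x - mono S x else 0 := by
    intro e
    split_ifs with he
    · rw [mono_update_true, mono_update_false_of_mem he]; ring
    · rw [mono_update_of_notMem he, mono_update_of_notMem he]; ring
  rw [glauber_apply]
  simp only [h, Finset.sum_add_distrib, Finset.sum_ite_mem, Finset.univ_inter,
    Finset.sum_sub_distrib, Finset.sum_const, Finset.card_univ, nsmul_eq_mul, Pi.add_apply,
    Pi.smul_apply, smul_eq_mul, Finset.sum_apply, ← Finset.mul_sum]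
  have := card_inv_mul_card (E := E)
  linear_combination mono S x * this

theorem abs_glauber_const_pow_mono_sub_le [Nonempty E] {q : ℝ} (hq0 : 0 ≤ q) (hq1 : q ≤ 1)
    (t : ℕ) (S : Finset E) (x : E → Bool) :
    |(glauber (fun _ _ => q) ^ t) (mono S) x - q ^ #S| ≤
      #S * (1 - (Fintype.card E : ℝ)⁻¹) ^ t := by
  set r : ℝ := (Fintype.card E : ℝ)⁻¹ with hr
  have hr0 : 0 ≤ r := by positivity
  have hr1 : r ≤ 1 := card_inv_le_one
  induction t generalizing S with
  | zero =>
    rcases S.eq_empty_or_nonempty with rfl | hS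
    · simp [mono_empty]
    · have h1 : (1 : ℝ) ≤ #S := Nat.one_le_cast.mpr hS.card_pos
      have h2 : (0 : ℝ) ≤ q ^ #S := by positivity
      have h3 : q ^ #S ≤ 1 := pow_le_one₀ hq0 hq1
      have h4 := mono_nonneg S x
      have h5 := mono_le_one S x
      simp only [pow_zero, Module.End.one_apply, mul_one]
      rw [abs_le]
      constructor <;> linarith
  | succ t ih =>
    rcases S.eq_empty_or_nonempty with rfl | hS
    · rw [mono_empty, glauber_pow_const]; simp
    have hS1 : 1 ≤ #S := hS.card_pos
    have hrS : r * #S ≤ 1 := card_inv_mul_card_le_one S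
    rw [glauber_pow_succ_apply, glauber_const_mono, map_add, map_smul, map_smul, map_sum]
    simp only [Pi.add_apply, Pi.smul_apply, smul_eq_mul, Finset.sum_apply]
    set Q := glauber (E := E) (fun _ _ => q) ^ t
    have hq : q ^ #S = q * q ^ (#S - 1) := by
      rw [← pow_succ', Nat.sub_add_cancel hS1]
    have hsum : (1 - r * #S) * Q (mono S) x + r * q * ∑ e ∈ S, Q (mono (S.erase e)) x - q ^ #S =
        (1 - r * #S) * (Q (mono S) x - q ^ #S) +
          r * q * ∑ e ∈ S, (Q (mono (S.erase e)) x - q ^ (#S - 1)) := by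
      rw [Finset.sum_sub_distrib, Finset.sum_const, nsmul_eq_mul]
      linear_combination (-r * #S) * hq
    rw [hsum]
    have hb : |∑ e ∈ S, (Q (mono (S.erase e)) x - q ^ (#S - 1))| ≤
        #S * (((#S : ℝ) - 1) * (1 - r) ^ t) := by
      refine (Finset.abs_sum_le_sum_abs _ _).trans ?_
      rw [← nsmul_eq_mul]
      refine Finset.sum_le_card_nsmul _ _ _ fun e he => ?_
      have := ih (S.erase e)
      rw [Finset.card_erase_of_mem he, Nat.cast_sub hS1, Nat.cast_one] at this
      exact this
    have hS1' : (1 : ℝ) ≤ #S := Nat.one_le_cast.mpr hS1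
    have hpow : 0 ≤ (1 - r) ^ t := pow_nonneg (by linarith) t
    calc _ ≤ |(1 - r * #S) * (Q (mono S) x - q ^ #S)| +
          |r * q * ∑ e ∈ S, (Q (mono (S.erase e)) x - q ^ (#S - 1))| := abs_add_le _ _
      _ = (1 - r * #S) * |Q (mono S) x - q ^ #S| +
          r * q * |∑ e ∈ S, (Q (mono (S.erase e)) x - q ^ (#S - 1))| := by
        rw [abs_mul, abs_mul, abs_of_nonneg (sub_nonneg.mpr hrS),
          abs_of_nonneg (mul_nonneg hr0 hq0)]
      _ ≤ (1 - r * #S) * (#S * (1 - r) ^ t) +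
          r * 1 * (#S * (((#S : ℝ) - 1) * (1 - r) ^ t)) := by
        refine add_le_add (mul_le_mul_of_nonneg_left (ih S) (sub_nonneg.mpr hrS)) ?_
        refine mul_le_mul (mul_le_mul_of_nonneg_left hq1 hr0) hb (abs_nonneg _) (by linarith)
      _ = #S * (1 - r) ^ (t + 1) := by ring

theorem glauber_const_lipschitz {q : ℝ} (hq0 : 0 ≤ q) (hq1 : q ≤ 1) {f : (E → Bool) → ℝ}
    {L : E → ℝ}
    (hL : ∀ x e, |f (Function.update x e true) - f (Function.update x e false)| ≤ L e)
    (x : E → Bool) (e : E) :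
    |glauber (fun _ _ => q) f (Function.update x e true) -
      glauber (fun _ _ => q) f (Function.update x e false)| ≤
      (1 - (Fintype.card E : ℝ)⁻¹) * L e := by
  have : Nonempty E := ⟨e⟩
  have hL0 : 0 ≤ L e := (abs_nonneg _).trans (hL x e)
  rw [glauber_apply, glauber_apply, ← mul_sub, ← Finset.sum_sub_distrib, abs_mul,
    abs_of_nonneg (by positivity : (0 : ℝ) ≤ (Fintype.card E : ℝ)⁻¹)]
  have h : |∑ e' : E, (q * f (Function.update (Function.update x e true) e' true) +
      (1 - q) * f (Function.update (Function.update x e true) e' false) -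
      (q * f (Function.update (Function.update x e false) e' true) +
      (1 - q) * f (Function.update (Function.update x e false) e' false)))| ≤
      ∑ e' : E, if e' = e then 0 else L e := by
    refine (Finset.abs_sum_le_sum_abs _ _).trans (Finset.sum_le_sum fun e' _ => ?_)
    split_ifs with he
    · subst he; simp
    · rw [Function.update_comm (β := fun _ => Bool) (Ne.symm he) true true, Function.update_comm (β := fun _ => Bool) (Ne.symm he) true false,
        Function.update_comm (β := fun _ => Bool) (Ne.symm he) false true, Function.update_comm (β := fun _ => Bool) (Ne.symm he) false false]
      have h1 := abs_le.mp (hL (Function.update x e' true) e)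
      have h2 := abs_le.mp (hL (Function.update x e' false) e)
      rw [abs_le]
      constructor <;> nlinarith
  refine (mul_le_mul_of_nonneg_left h (by positivity)).trans ?_
  have h2 : ∑ e' : E, (if e' = e then 0 else L e) = (Fintype.card E - 1) * L e := by
    have : ∀ e' : E, (if e' = e then 0 else L e) = L e - if e' = e then L e else 0 := by
      intro e'; split_ifs <;> simp
    simp only [this, Finset.sum_sub_distrib, Finset.sum_const, Finset.card_univ, nsmul_eq_mul,
      Finset.sum_ite_eq', Finset.mem_univ, if_true]
    ring
  rw [h2, ← mul_assoc, mul_sub, card_inv_mul_card, mul_one]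

theorem glauber_const_exp_le [Nonempty E] {q : ℝ} (hq0 : 0 ≤ q) (hq1 : q ≤ 1)
    {f : (E → Bool) → ℝ} {L : E → ℝ} (hL1 : ∀ e, L e ≤ 1)
    (hL : ∀ x e, |f (Function.update x e true) - f (Function.update x e false)| ≤ L e)
    (x : E → Bool) :
    glauber (fun _ _ => q) (fun y => Real.exp (f y)) x ≤
      Real.exp (glauber (fun _ _ => q) f x + (Fintype.card E : ℝ)⁻¹ * ∑ e, L e ^ 2) := by
  have hstep : ∀ (e : E) (b : Bool), |f (Function.update x e b) - f x| ≤ L e := by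
    intro e b
    have h := hL x e
    have h0 : 0 ≤ L e := (abs_nonneg _).trans h
    have hx : |f (Function.update x e b) - f (Function.update x e (x e))| ≤ L e := by
      cases b <;> cases x e <;>
        first | exact h | (rw [abs_sub_comm]; exact h) | (rw [sub_self, abs_zero]; exact h0)
    rwa [Function.update_eq_self] at hx
  have hexp : ∀ (e : E) (b : Bool), Real.exp (f (Function.update x e b)) ≤
      Real.exp (f x) * (1 + (f (Function.update x e b) - f x) + L e ^ 2) := by
    intro e b
    have h := hstep e b
    have h1 := Real.abs_exp_sub_one_sub_id_le (h.trans (hL1 e))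
    have h2 : (f (Function.update x e b) - f x) ^ 2 ≤ L e ^ 2 :=
      sq_le_sq' (abs_le.mp h).1 (abs_le.mp h).2
    have h3 : Real.exp (f (Function.update x e b)) =
        Real.exp (f x) * Real.exp (f (Function.update x e b) - f x) := by
      rw [← Real.exp_add]; congr 1; ring
    rw [h3]
    refine mul_le_mul_of_nonneg_left ?_ (Real.exp_pos _).le
    linarith [(abs_le.mp h1).2]
  have hsum : glauber (fun _ _ => q) (fun y => Real.exp (f y)) x ≤
      Real.exp (f x) * (1 + (glauber (fun _ _ => q) f x - f x) +
        (Fintype.card E : ℝ)⁻¹ * ∑ e, L e ^ 2) := by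
    have h1 : ∀ e : E, q * Real.exp (f (Function.update x e true)) +
        (1 - q) * Real.exp (f (Function.update x e false)) ≤
        Real.exp (f x) * ((q * f (Function.update x e true) +
          (1 - q) * f (Function.update x e false)) + L e ^ 2 + (1 - f x)) := by
      intro e
      have h2 := mul_le_mul_of_nonneg_left (hexp e true) hq0
      have h3 := mul_le_mul_of_nonneg_left (hexp e false) (sub_nonneg.mpr hq1)
      linarith
    rw [glauber_apply]
    refine (mul_le_mul_of_nonneg_left (Finset.sum_le_sum fun e _ => h1 e)
      (by positivity)).trans (le_of_eq ?_)
    rw [glauber_apply, ← Finset.mul_sum, Finset.sum_add_distrib, Finset.sum_add_distrib,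
      Finset.sum_const, Finset.card_univ, nsmul_eq_mul]
    linear_combination (Real.exp (f x) * (1 - f x)) * card_inv_mul_card (E := E)
  refine hsum.trans ?_
  have h4 := Real.add_one_le_exp ((glauber (fun _ _ => q) f x - f x) +
        (Fintype.card E : ℝ)⁻¹ * ∑ e, L e ^ 2)
  calc _ ≤ Real.exp (f x) * Real.exp ((glauber (fun _ _ => q) f x - f x) +
        (Fintype.card E : ℝ)⁻¹ * ∑ e, L e ^ 2) :=
        mul_le_mul_of_nonneg_left (by linarith) (Real.exp_pos _).le
    _ = _ := by rw [← Real.exp_add]; congr 1; ring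

theorem glauber_const_pow_exp_le [Nonempty E] {q : ℝ} (hq0 : 0 ≤ q) (hq1 : q ≤ 1) (t : ℕ)
    {f : (E → Bool) → ℝ} {L : E → ℝ} (hL1 : ∀ e, L e ≤ 1)
    (hL : ∀ x e, |f (Function.update x e true) - f (Function.update x e false)| ≤ L e)
    (x : E → Bool) :
    (glauber (fun _ _ => q) ^ t) (fun y => Real.exp (f y)) x ≤
      Real.exp ((glauber (fun _ _ => q) ^ t) f x + ∑ e, L e ^ 2) := by
  set r : ℝ := (Fintype.card E : ℝ)⁻¹ with hr
  have hr0 : 0 ≤ r := by positivity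
  have hr1 : r ≤ 1 := card_inv_le_one
  induction t generalizing f L with
  | zero =>
    simp only [pow_zero, Module.End.one_apply]
    exact Real.exp_le_exp.mpr (le_add_of_nonneg_right (by positivity))
  | succ t ih =>
    have hL0 : ∀ e, 0 ≤ L e := fun e => (abs_nonneg _).trans (hL x e)
    have hV : 0 ≤ ∑ e, L e ^ 2 := by positivity
    rw [glauber_pow_succ_apply, glauber_pow_succ_apply]
    refine (glauber_pow_le (fun _ _ => hq0) (fun _ _ => hq1) t
      (g := Real.exp (r * ∑ e, L e ^ 2) •
        fun y => Real.exp (glauber (fun _ _ => q) f y)) (fun y => ?_) x).trans ?_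
    · rw [Pi.smul_apply, smul_eq_mul, ← Real.exp_add, add_comm]
      exact glauber_const_exp_le hq0 hq1 hL1 hL y
    · have hih := ih (f := glauber (fun _ _ => q) f) (L := fun e => (1 - r) * L e)
        (fun e => by nlinarith [hL0 e, hL1 e])
        (fun y e => glauber_const_lipschitz hq0 hq1 hL y e)
      rw [map_smul, Pi.smul_apply, smul_eq_mul]
      refine (mul_le_mul_of_nonneg_left hih (Real.exp_pos _).le).trans ?_
      rw [← Real.exp_add]
      apply Real.exp_le_exp.mpr
      simp only [mul_pow, ← Finset.mul_sum]
      nlinarith [mul_nonneg (mul_nonneg hr0 (sub_nonneg.mpr hr1)) hV]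

/-- Exponential concentration for the chain with constant rates. -/
theorem glauber_const_pow_indicator_le [Nonempty E] {q : ℝ} (hq0 : 0 ≤ q) (hq1 : q ≤ 1) (t : ℕ)
    {f : (E → Bool) → ℝ} {L : E → ℝ} {m η v l : ℝ} (hl : 0 ≤ l) (hl1 : ∀ e, l * L e ≤ 1)
    (hL : ∀ x e, |f (Function.update x e true) - f (Function.update x e false)| ≤ L e)
    (hv : ∑ e, L e ^ 2 ≤ v) {x : E → Bool} (hm : (glauber (fun _ _ => q) ^ t) f x ≤ m) :
    (glauber (fun _ _ => q) ^ t) ({y | m + η < f y}.indicator 1) x ≤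
      Real.exp (l ^ 2 * v - l * η) := by
  have h1 := glauber_pow_le (fun _ _ => hq0) (fun _ _ => hq1) t
    (f := {y | m + η < f y}.indicator 1)
    (g := Real.exp (-(l * (m + η))) • fun y => Real.exp ((l • f) y)) (fun y => by
      rw [Pi.smul_apply, smul_eq_mul, ← Real.exp_add]
      by_cases hy : m + η < f y
      · rw [Set.indicator_of_mem (by exact hy), Pi.one_apply]
        apply Real.one_le_exp
        simp only [Pi.smul_apply, smul_eq_mul]
        nlinarith
      · rw [Set.indicator_of_notMem (by exact hy)]
        positivity) x
  refine h1.trans ?_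
  rw [map_smul, Pi.smul_apply, smul_eq_mul]
  have h2 := glauber_const_pow_exp_le hq0 hq1 t (f := l • f) (L := fun e => l * L e) hl1
    (fun y e => by
      simp only [Pi.smul_apply, smul_eq_mul]
      rw [← mul_sub, abs_mul, abs_of_nonneg hl]
      exact mul_le_mul_of_nonneg_left (hL y e) hl) x
  refine (mul_le_mul_of_nonneg_left h2 (Real.exp_pos _).le).trans ?_
  rw [← Real.exp_add]
  apply Real.exp_le_exp.mpr
  rw [map_smul]
  simp only [mul_pow, ← Finset.mul_sum, Pi.smul_apply, smul_eq_mul]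
  nlinarith [mul_le_mul_of_nonneg_left hv (sq_nonneg l), mul_le_mul_of_nonneg_left hm hl]

end ConstantRate

section Reversible

variable {E : Type*} [DecidableEq E]

/-- The weight of the flip at `e` in the heat-bath chain with rates `a`. -/
noncomputable def flipWeight (a : E → (E → Bool) → ℝ) (x : E → Bool) (e : E) : ℝ :=
  if x e = true then 1 - a e x else a e x

theorem sum_update_not [Fintype E] (e : E) (F : (E → Bool) → ℝ) :
    ∑ x : E → Bool, F (Function.update x e (!(x e))) = ∑ x, F x := by
  have hinv : Function.Involutive (fun x : E → Bool => Function.update x e (!(x e))) := by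
    intro x; simp
  exact Equiv.sum_comp hinv.toPerm F

/-- `π` is a probability vector on the cube satisfying detailed balance for the heat-bath chain
with rates `a`. -/
structure IsReversible [Fintype E] (a : E → (E → Bool) → ℝ) (π : (E → Bool) → ℝ) : Prop where
  nonneg : ∀ x, 0 ≤ π x
  sum_eq_one : ∑ x, π x = 1
  rate_nonneg : ∀ e x, 0 ≤ a e x
  rate_le_one : ∀ e x, a e x ≤ 1
  balance : ∀ x e, π x * flipWeight a x e =
    π (Function.update x e (!(x e))) * flipWeight a (Function.update x e (!(x e))) e

variable [Fintype E]

theorem sub_glauber_apply [Nonempty E] {a : E → (E → Bool) → ℝ} (f : (E → Bool) → ℝ)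
    (x : E → Bool) :
    f x - glauber a f x = (Fintype.card E : ℝ)⁻¹ *
      ∑ e, flipWeight a x e * (f x - f (Function.update x e (!(x e)))) := by
  have h : ∀ e, a e x * f (Function.update x e true) + (1 - a e x) * f (Function.update x e false)
      = f x - flipWeight a x e * (f x - f (Function.update x e (!(x e)))) := by
    intro e
    unfold flipWeight
    rcases hx : x e
    · have : Function.update x e false = x := by rw [← hx, Function.update_eq_self]
      simp [this]; ring
    · have : Function.update x e true = x := by rw [← hx, Function.update_eq_self]
      simp [this]; ring
  rw [glauber_apply]
  simp only [h, Finset.sum_sub_distrib, Finset.sum_const, Finset.card_univ, nsmul_eq_mul]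
  linear_combination (-f x) * card_inv_mul_card (E := E)

variable {a : E → (E → Bool) → ℝ} {π : (E → Bool) → ℝ}

theorem IsReversible.sum_mul_sub_glauber [Nonempty E] (h : IsReversible a π)
    (f g : (E → Bool) → ℝ) :
    ∑ x, π x * (g x * (f x - glauber a f x)) = 2⁻¹ * ((Fintype.card E : ℝ)⁻¹ *
      ∑ x, ∑ e, π x * flipWeight a x e * ((g (Function.update x e (!(x e))) - g x) *
        (f (Function.update x e (!(x e))) - f x))) := by
  have key : ∀ e, ∑ x, π x * flipWeight a x e * (g x *
      (f x - f (Function.update x e (!(x e))))) = 2⁻¹ *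
      ∑ x, π x * flipWeight a x e * ((g (Function.update x e (!(x e))) - g x) *
        (f (Function.update x e (!(x e))) - f x)) := by
    intro e
    have h1 : ∑ x, π x * flipWeight a x e * (g x * (f x - f (Function.update x e (!(x e))))) =
        ∑ x, π x * flipWeight a x e * (g (Function.update x e (!(x e))) *
          (f (Function.update x e (!(x e))) - f x)) := by
      rw [← sum_update_not e]
      refine Finset.sum_congr rfl fun x _ => ?_
      rw [← h.balance x e]
      simp
    have h2 : ∑ x, π x * flipWeight a x e * ((g (Function.update x e (!(x e))) - g x) *
        (f (Function.update x e (!(x e))) - f x)) =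
        ∑ x, π x * flipWeight a x e * (g (Function.update x e (!(x e))) *
          (f (Function.update x e (!(x e))) - f x)) +
        ∑ x, π x * flipWeight a x e * (g x * (f x - f (Function.update x e (!(x e))))) := by
      rw [← Finset.sum_add_distrib]
      exact Finset.sum_congr rfl fun x _ => by ring
    rw [h2, ← h1]; ring
  have h3 : ∀ x, π x * (g x * (f x - glauber a f x)) = (Fintype.card E : ℝ)⁻¹ *
      ∑ e, π x * flipWeight a x e * (g x * (f x - f (Function.update x e (!(x e))))) := by
    intro x
    rw [sub_glauber_apply, Finset.mul_sum, Finset.mul_sum, Finset.mul_sum, Finset.mul_sum]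
    exact Finset.sum_congr rfl fun e _ => by ring
  simp only [h3, ← Finset.mul_sum]
  rw [Finset.sum_comm]
  simp only [key, ← Finset.mul_sum]
  rw [Finset.sum_comm]; ring

theorem IsReversible.symm_glauber [Nonempty E] (h : IsReversible a π) (f g : (E → Bool) → ℝ) :
    ∑ x, π x * (g x * glauber a f x) = ∑ x, π x * (glauber a g x * f x) := by
  have h1 := h.sum_mul_sub_glauber f g
  have h2 := h.sum_mul_sub_glauber g f
  have h3 : ∑ x, π x * (g x * (f x - glauber a f x)) =
      ∑ x, π x * (f x * (g x - glauber a g x)) := by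
    rw [h1, h2]
    congr 2
    exact Finset.sum_congr rfl fun x _ => Finset.sum_congr rfl fun e _ => by ring
  have h4 : ∑ x, π x * (g x * glauber a f x) =
      ∑ x, π x * (g x * f x) - ∑ x, π x * (g x * (f x - glauber a f x)) := by
    rw [← Finset.sum_sub_distrib]; exact Finset.sum_congr rfl fun x _ => by ring
  rw [h4, h3, ← Finset.sum_sub_distrib]
  exact Finset.sum_congr rfl fun x _ => by ring

theorem IsReversible.symm_glauber_pow [Nonempty E] (h : IsReversible a π) (t : ℕ)
    (f g : (E → Bool) → ℝ) :
    ∑ x, π x * (g x * (glauber a ^ t) f x) = ∑ x, π x * ((glauber a ^ t) g x * f x) := by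
  induction t generalizing f g with
  | zero => rfl
  | succ t ih => rw [glauber_pow_succ_apply, ih, h.symm_glauber, ← glauber_pow_succ_apply']

theorem IsReversible.sum_glauber_pow [Nonempty E] (h : IsReversible a π) (t : ℕ)
    (f : (E → Bool) → ℝ) : ∑ x, π x * (glauber a ^ t) f x = ∑ x, π x * f x := by
  have := h.symm_glauber_pow t f (fun _ => 1)
  rw [glauber_pow_const] at this
  simpa using this

theorem abs_glauber_pow_sub_le [Nonempty E] (h0 : ∀ e x, 0 ≤ a e x) (h1 : ∀ e x, a e x ≤ 1)
    (t : ℕ) {f : (E → Bool) → ℝ} {D : ℝ} (hf : ∀ x y, |f x - f y| ≤ D) (x y : E → Bool) :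
    |(glauber a ^ t) f x - (glauber a ^ t) f y| ≤ D := by
  obtain ⟨z, hz⟩ := Finite.exists_min f
  have hup : ∀ x, f x ≤ f z + D := fun x => by linarith [(abs_le.mp (hf x z)).2]
  have hx1 := const_le_glauber_pow h0 h1 t hz x
  have hx2 := glauber_pow_le_const h0 h1 t hup x
  have hy1 := const_le_glauber_pow h0 h1 t hz y
  have hy2 := glauber_pow_le_const h0 h1 t hup y
  rw [abs_le]
  constructor <;> linarith

theorem abs_glauber_pow_sub_le_of_contraction [Nonempty E] (h0 : ∀ e x, 0 ≤ a e x)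
    (h1 : ∀ e x, a e x ≤ 1) {T : ℕ} (hT : 0 < T) {ρ : ℝ} (hρ0 : 0 < ρ) (hρ1 : ρ ≤ 1)
    (hcon : ∀ (f : (E → Bool) → ℝ) (D : ℝ), (∀ x y, |f x - f y| ≤ D) →
      ∀ x y, |(glauber a ^ T) f x - (glauber a ^ T) f y| ≤ ρ ^ T * D)
    (t : ℕ) {f : (E → Bool) → ℝ} {D : ℝ} (hf : ∀ x y, |f x - f y| ≤ D) (x y : E → Bool) :
    |(glauber a ^ t) f x - (glauber a ^ t) f y| ≤ D / ρ ^ T * ρ ^ t := by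
  have hD : 0 ≤ D := (abs_nonneg _).trans (hf x y)
  have hk : ∀ (k : ℕ) (f : (E → Bool) → ℝ) (D : ℝ), (∀ x y, |f x - f y| ≤ D) →
      ∀ x y, |(glauber a ^ (T * k)) f x - (glauber a ^ (T * k)) f y| ≤ ρ ^ (T * k) * D := by
    intro k
    induction k with
    | zero => intro f D hf x y; simpa using hf x y
    | succ k ih =>
      intro f D hf x y
      rw [mul_add, mul_one, glauber_pow_add_apply, pow_add, mul_assoc]
      exact ih _ _ (hcon f D hf) x y
  have h2 := hk (t / T) _ _ (abs_glauber_pow_sub_le h0 h1 (t % T) hf) x y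
  rw [← glauber_pow_add_apply, Nat.div_add_mod] at h2
  refine h2.trans ?_
  rw [div_mul_eq_mul_div, le_div_iff₀ (pow_pos hρ0 T), mul_comm (ρ ^ (T * (t / T))), mul_assoc]
  refine mul_le_mul_of_nonneg_left ?_ hD
  rw [← pow_add]
  refine pow_le_pow_of_le_one hρ0.le hρ1 ?_
  have := Nat.div_add_mod t T
  have := Nat.mod_lt t hT
  omega

theorem IsReversible.abs_le_of_sum_eq_zero (h : IsReversible a π) {f : (E → Bool) → ℝ} {D : ℝ}
    (hf : ∀ x y, |f x - f y| ≤ D) (h0 : ∑ x, π x * f x = 0) (x : E → Bool) : |f x| ≤ D := by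
  have h1 : f x = ∑ y, π y * (f x - f y) := by
    simp only [mul_sub, Finset.sum_sub_distrib, h0, ← Finset.sum_mul, h.sum_eq_one]; ring
  rw [h1]
  refine (Finset.abs_sum_le_sum_abs _ _).trans ?_
  calc _ ≤ ∑ y, π y * D := Finset.sum_le_sum fun y _ => by
        rw [abs_mul, abs_of_nonneg (h.nonneg y)]
        exact mul_le_mul_of_nonneg_left (hf x y) (h.nonneg y)
    _ = D := by rw [← Finset.sum_mul, h.sum_eq_one, one_mul]

theorem IsReversible.sq_sum_mul_le (h : IsReversible a π) (f g : (E → Bool) → ℝ) :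
    (∑ x, π x * (f x * g x)) ^ 2 ≤ (∑ x, π x * (f x * f x)) * ∑ x, π x * (g x * g x) := by
  refine Finset.sum_sq_le_sum_mul_sum_of_sq_le_mul _ (fun x _ => ?_) (fun x _ => ?_)
    (fun x _ => ?_)
  · exact mul_nonneg (h.nonneg x) (mul_self_nonneg _)
  · exact mul_nonneg (h.nonneg x) (mul_self_nonneg _)
  · exact le_of_eq (by ring)

theorem IsReversible.pow_le_sum_glauber_pow [Nonempty E] (h : IsReversible a π)
    {f : (E → Bool) → ℝ} (hf : ∑ x, π x * (f x * f x) = 1)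
    (hr : 0 ≤ ∑ x, π x * (f x * glauber a f x)) (m : ℕ) :
    (∑ x, π x * (f x * glauber a f x)) ^ 2 ^ m ≤ ∑ x, π x * (f x * (glauber a ^ 2 ^ m) f x) := by
  induction m with
  | zero => simp
  | succ m ih =>
    have h1 := h.sq_sum_mul_le f ((glauber a ^ 2 ^ m) f)
    rw [hf, one_mul] at h1
    have h2 : ∑ x, π x * (f x * (glauber a ^ 2 ^ (m + 1)) f x) =
        ∑ x, π x * ((glauber a ^ 2 ^ m) f x * (glauber a ^ 2 ^ m) f x) := by
      rw [pow_succ 2 m, mul_two, glauber_pow_add_apply, h.symm_glauber_pow]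
    rw [h2, pow_succ 2 m, pow_mul]
    exact (pow_le_pow_left₀ (pow_nonneg hr _) ih 2).trans h1

/-- Geometric decay of oscillations of the semigroup forces the one-step correlations of
centred functions to be small. -/
theorem IsReversible.sum_mul_glauber_le [Nonempty E] (h : IsReversible a π)
    {T : ℕ} (hT : 0 < T) {ρ : ℝ} (hρ0 : 0 < ρ) (hρ1 : ρ ≤ 1)
    (hcon : ∀ (f : (E → Bool) → ℝ) (D : ℝ), (∀ x y, |f x - f y| ≤ D) →
      ∀ x y, |(glauber a ^ T) f x - (glauber a ^ T) f y| ≤ ρ ^ T * D)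
    {f : (E → Bool) → ℝ} (h0 : ∑ x, π x * f x = 0) (hf : ∑ x, π x * (f x * f x) = 1) :
    ∑ x, π x * (f x * glauber a f x) ≤ ρ := by
  by_contra! hlt
  set r := ∑ x, π x * (f x * glauber a f x) with hr
  obtain ⟨D, hD⟩ : ∃ D, ∀ x y, |f x - f y| ≤ D := by
    obtain ⟨z, hz⟩ := Finite.exists_max (fun p : (E → Bool) × (E → Bool) => |f p.1 - f p.2|)
    exact ⟨_, fun x y => hz (x, y)⟩
  have hD0 : 0 ≤ D := (abs_nonneg _).trans (hD (fun _ => true) (fun _ => true))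
  have hbound : ∀ m : ℕ, r ^ 2 ^ m ≤ D * (D / ρ ^ T) * ρ ^ 2 ^ m := by
    intro m
    refine (h.pow_le_sum_glauber_pow hf (hρ0.trans hlt).le m).trans ?_
    have h1 := h.abs_le_of_sum_eq_zero (f := (glauber a ^ 2 ^ m) f)
      (abs_glauber_pow_sub_le_of_contraction h.rate_nonneg h.rate_le_one hT hρ0 hρ1 hcon (2 ^ m) hD)
      (by rw [h.sum_glauber_pow, h0])
    have h2 := h.abs_le_of_sum_eq_zero hD h0
    calc _ ≤ ∑ x, π x * (D * (D / ρ ^ T * ρ ^ 2 ^ m)) := Finset.sum_le_sum fun x _ => by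
          refine mul_le_mul_of_nonneg_left ((le_abs_self _).trans ?_) (h.nonneg x)
          rw [abs_mul]
          exact mul_le_mul (h2 x) (h1 x) (abs_nonneg _) hD0
      _ = _ := by rw [← Finset.sum_mul, h.sum_eq_one]; ring
  have hq : 1 < r / ρ := (one_lt_div hρ0).mpr hlt
  obtain ⟨k, hk⟩ := pow_unbounded_of_one_lt (D * (D / ρ ^ T)) hq
  have h3 : (r / ρ) ^ k ≤ (r / ρ) ^ 2 ^ k :=
    pow_le_pow_right₀ hq.le (Nat.lt_two_pow_self).le
  have h4 : (r / ρ) ^ 2 ^ k ≤ D * (D / ρ ^ T) := by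
    rw [div_pow, div_le_iff₀ (pow_pos hρ0 _)]
    exact hbound k
  linarith

/-- Poincaré inequality from geometric decay of oscillations. -/
theorem IsReversible.poincare [Nonempty E] (h : IsReversible a π)
    {T : ℕ} (hT : 0 < T) {ρ : ℝ} (hρ0 : 0 < ρ) (hρ1 : ρ ≤ 1)
    (hcon : ∀ (f : (E → Bool) → ℝ) (D : ℝ), (∀ x y, |f x - f y| ≤ D) →
      ∀ x y, |(glauber a ^ T) f x - (glauber a ^ T) f y| ≤ ρ ^ T * D)
    {f : (E → Bool) → ℝ} (h0 : ∑ x, π x * f x = 0) :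
    2 * (1 - ρ) * ∑ x, π x * f x ^ 2 ≤ (Fintype.card E : ℝ)⁻¹ *
      ∑ x, ∑ e, flipWeight a x e * (f (Function.update x e (!(x e))) - f x) ^ 2 * π x := by
  have hE : (Fintype.card E : ℝ)⁻¹ *
      ∑ x, ∑ e, flipWeight a x e * (f (Function.update x e (!(x e))) - f x) ^ 2 * π x =
      2 * (∑ x, π x * (f x * f x) - ∑ x, π x * (f x * glauber a f x)) := by
    have h1 := h.sum_mul_sub_glauber f f
    have h2 : ∑ x, π x * (f x * (f x - glauber a f x)) =
        ∑ x, π x * (f x * f x) - ∑ x, π x * (f x * glauber a f x) := by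
      rw [← Finset.sum_sub_distrib]; exact Finset.sum_congr rfl fun x _ => by ring
    rw [← h2, h1]
    rw [← mul_assoc 2 2⁻¹, mul_inv_cancel₀ two_ne_zero, one_mul]
    congr 1
    exact Finset.sum_congr rfl fun x _ => Finset.sum_congr rfl fun e _ => by ring
  rw [hE]
  simp only [pow_two]
  set N := ∑ x, π x * (f x * f x) with hN
  have hN0 : 0 ≤ N := Finset.sum_nonneg fun x _ => mul_nonneg (h.nonneg x) (mul_self_nonneg _)
  suffices hs : ∑ x, π x * (f x * glauber a f x) ≤ ρ * N by linarith
  rcases hN0.eq_or_lt with hz | hpos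
  · have h1 := h.sq_sum_mul_le f (glauber a f)
    rw [← hN, ← hz, zero_mul] at h1
    rw [← hz, mul_zero, pow_eq_zero_iff two_ne_zero |>.mp (le_antisymm h1 (sq_nonneg _))]
  · have hs : (√N)⁻¹ * (√N)⁻¹ = N⁻¹ := by
      rw [← mul_inv, Real.mul_self_sqrt hN0]
    have h1 := h.sum_mul_glauber_le hT hρ0 hρ1 hcon (f := (√N)⁻¹ • f) (by
      have : ∀ x, π x * ((√N)⁻¹ • f) x = (√N)⁻¹ * (π x * f x) := fun x => mul_left_comm _ _ _
      simp only [this, ← Finset.mul_sum, h0, mul_zero]) (by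
      have : ∀ x, π x * (((√N)⁻¹ • f) x * ((√N)⁻¹ • f) x) = N⁻¹ * (π x * (f x * f x)) := by
        intro x
        simp only [Pi.smul_apply, smul_eq_mul]
        rw [← hs]; ring
      simp only [this, ← Finset.mul_sum]
      rw [← hN, inv_mul_cancel₀ hpos.ne'])
    have h2 : ∀ x, π x * (((√N)⁻¹ • f) x * glauber a ((√N)⁻¹ • f) x) =
        N⁻¹ * (π x * (f x * glauber a f x)) := by
      intro x
      rw [map_smul]
      simp only [Pi.smul_apply, smul_eq_mul]
      rw [← hs]; ring
    simp only [h2, ← Finset.mul_sum] at h1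
    rwa [inv_mul_le_iff₀ hpos, mul_comm N] at h1

/-- If `Σ x_e` contracts between the extremal starting states, oscillations of every function
contract. -/
theorem abs_glauber_pow_sub_le_of_monotone [Nonempty E] (h0 : ∀ e x, 0 ≤ a e x)
    (h1 : ∀ e x, a e x ≤ 1) (ha : ∀ e, Monotone (a e)) (T : ℕ) {d : ℝ}
    (hd : (glauber a ^ T) (∑ e, mono {e}) ⊤ - (glauber a ^ T) (∑ e, mono {e}) ⊥ ≤ d)
    (f : (E → Bool) → ℝ) (D : ℝ) (hf : ∀ x y, |f x - f y| ≤ D) (x y : E → Bool) :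
    |(glauber a ^ T) f x - (glauber a ^ T) f y| ≤ d * D := by
  set S : (E → Bool) → ℝ := ∑ e, mono {e} with hS
  have hD : 0 ≤ D := (abs_nonneg _).trans (hf x y)
  have hSup : ∀ x e, S (Function.update x e true) - S (Function.update x e false) = 1 := by
    intro x e
    simp only [hS, Finset.sum_apply, ← Finset.sum_sub_distrib, mono_update_sub,
      Finset.mem_singleton, Finset.sum_ite_eq, Finset.mem_univ, if_true]
    simp [mono]
  have hmono : ∀ g : (E → Bool) → ℝ, (∀ x y, |g x - g y| ≤ D) → Monotone (D • S + g) := by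
    intro g hg
    refine monotone_of_update fun x e => ?_
    have h2 := (abs_le.mp (hg (Function.update x e true) (Function.update x e false))).1
    have h3 := hSup x e
    simp only [Pi.add_apply, Pi.smul_apply, smul_eq_mul]
    nlinarith
  have hbt : ∀ g : (E → Bool) → ℝ, Monotone g → ∀ x y,
      (glauber a ^ T) g x - (glauber a ^ T) g y ≤ (glauber a ^ T) g ⊤ - (glauber a ^ T) g ⊥ := by
    intro g hg x y
    have h2 := glauber_pow_monotone h0 h1 ha T hg
    exact sub_le_sub (h2 le_top) (h2 bot_le)
  have hfin : ∀ x y, (glauber a ^ T) f x - (glauber a ^ T) f y ≤ d * D := by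
    intro x y
    have h2 := hbt _ (hmono f hf) x y
    have h3 := hbt _ (hmono (-f) (fun x y => by
      simp only [Pi.neg_apply]; rw [← abs_neg]; convert hf x y using 2; ring)) y x
    simp only [map_add, map_smul, map_neg, Pi.add_apply, Pi.smul_apply, Pi.neg_apply,
      smul_eq_mul] at h2 h3
    nlinarith [mul_le_mul_of_nonneg_left hd hD]
  rw [abs_le]
  exact ⟨by linarith [hfin y x], hfin x y⟩

end Reversible

section Polynomials

variable {E : Type*} [Fintype E] [DecidableEq E] {ι : Type*} [Fintype ι]

/-- The polynomial on the cube with weights `w` and monomials indexed by the sets `S`. -/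
noncomputable def poly (w : ι → ℝ) (S : ι → Finset E) (x : E → Bool) : ℝ :=
  ∑ i, w i * mono (S i) x

omit [Fintype E] [DecidableEq E] in
theorem poly_monotone {w : ι → ℝ} (hw : ∀ i, 0 ≤ w i) (S : ι → Finset E) :
    Monotone (poly w S) := fun _ _ hxy =>
  Finset.sum_le_sum fun i _ => mul_le_mul_of_nonneg_left (mono_monotone (S i) hxy) (hw i)

omit [Fintype E] [DecidableEq E] in
theorem poly_nonneg {w : ι → ℝ} (hw : ∀ i, 0 ≤ w i) (S : ι → Finset E) (x : E → Bool) :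
    0 ≤ poly w S x :=
  Finset.sum_nonneg fun i _ => mul_nonneg (hw i) (mono_nonneg _ _)

omit [Fintype E] [DecidableEq E] in
theorem poly_le_sum {w : ι → ℝ} (hw : ∀ i, 0 ≤ w i) (S : ι → Finset E) (x : E → Bool) :
    poly w S x ≤ ∑ i, w i :=
  Finset.sum_le_sum fun i _ => mul_le_of_le_one_right (hw i) (mono_le_one _ _)

omit [Fintype E] in
theorem poly_update_sub (w : ι → ℝ) (S : ι → Finset E) (x : E → Bool) (e : E) :
    poly w S (Function.update x e true) - poly w S (Function.update x e false) =
      poly (fun i => if e ∈ S i then w i else 0) (fun i => (S i).erase e) x := by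
  unfold poly
  rw [← Finset.sum_sub_distrib]
  refine Finset.sum_congr rfl fun i _ => ?_
  rw [← mul_sub, mono_update_sub]
  by_cases he : e ∈ S i <;> simp [he]

omit [Fintype E] in
theorem abs_poly_update_sub_le {w : ι → ℝ} (hw : ∀ i, 0 ≤ w i) (S : ι → Finset E)
    (x : E → Bool) (e : E) :
    |poly w S (Function.update x e true) - poly w S (Function.update x e false)| ≤
      ∑ i, if e ∈ S i then w i else 0 := by
  have h : ∀ i, 0 ≤ if e ∈ S i then w i else 0 := fun i => by split_ifs <;> simp [hw]
  rw [poly_update_sub, abs_of_nonneg (poly_nonneg h _ x)]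
  exact poly_le_sum h _ x

theorem sum_sq_influence_le {w : ι → ℝ} (hw : ∀ i, 0 ≤ w i) {S : ι → Finset E} {m W B : ℝ}
    (hm : ∀ i, (#(S i) : ℝ) ≤ m) (hm0 : 0 ≤ m) (hW : ∑ i, w i ≤ W)
    (hB0 : 0 ≤ B) (hB : ∀ e, ∑ i, (if e ∈ S i then w i else 0) ≤ B) :
    ∑ e, (∑ i, if e ∈ S i then w i else 0) ^ 2 ≤ m * W * B := by
  have h0 : ∀ e, 0 ≤ ∑ i, if e ∈ S i then w i else 0 := fun e =>
    Finset.sum_nonneg fun i _ => by split_ifs <;> simp [hw]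
  calc ∑ e, (∑ i, if e ∈ S i then w i else 0) ^ 2
      ≤ ∑ e, (∑ i, if e ∈ S i then w i else 0) * B := Finset.sum_le_sum fun e _ => by
        rw [pow_two]; exact mul_le_mul_of_nonneg_left (hB e) (h0 e)
    _ = (∑ i, w i * #(S i)) * B := by
        rw [← Finset.sum_mul, Finset.sum_comm]
        congr 1
        refine Finset.sum_congr rfl fun i _ => ?_
        rw [Finset.sum_ite_mem, Finset.univ_inter, Finset.sum_const, nsmul_eq_mul, mul_comm]
    _ ≤ (∑ i, w i * m) * B := by
        refine mul_le_mul_of_nonneg_right (Finset.sum_le_sum fun i _ => ?_) hB0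
        exact mul_le_mul_of_nonneg_left (hm i) (hw i)
    _ ≤ m * W * B := by
        rw [← Finset.sum_mul, mul_comm m W]
        exact mul_le_mul_of_nonneg_right (mul_le_mul_of_nonneg_right hW hm0) hB0

theorem abs_glauber_const_pow_poly_sub_le [Nonempty E] {q : ℝ} (hq0 : 0 ≤ q) (hq1 : q ≤ 1)
    (t : ℕ) {w : ι → ℝ} (hw : ∀ i, 0 ≤ w i) {S : ι → Finset E} {m W : ℝ}
    (hm : ∀ i, (#(S i) : ℝ) ≤ m) (hm0 : 0 ≤ m) (hW : ∑ i, w i ≤ W) (x : E → Bool) :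
    |(glauber (fun _ _ => q) ^ t) (poly w S) x - ∑ i, w i * q ^ #(S i)| ≤
      m * W * (1 - (Fintype.card E : ℝ)⁻¹) ^ t := by
  have hr : (0 : ℝ) ≤ (1 - (Fintype.card E : ℝ)⁻¹) ^ t :=
    pow_nonneg (sub_nonneg.mpr card_inv_le_one) t
  have h1 : poly w S = ∑ i, w i • mono (S i) := by
    funext x; simp [poly, Finset.sum_apply]
  rw [h1, map_sum, Finset.sum_apply, ← Finset.sum_sub_distrib]
  refine (Finset.abs_sum_le_sum_abs _ _).trans ?_
  calc _ ≤ ∑ i, w i * (m * (1 - (Fintype.card E : ℝ)⁻¹) ^ t) := by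
        refine Finset.sum_le_sum fun i _ => ?_
        rw [map_smul, Pi.smul_apply, smul_eq_mul, ← mul_sub, abs_mul, abs_of_nonneg (hw i)]
        refine mul_le_mul_of_nonneg_left ?_ (hw i)
        exact (abs_glauber_const_pow_mono_sub_le hq0 hq1 t (S i) x).trans
          (mul_le_mul_of_nonneg_right (hm i) hr)
    _ ≤ W * (m * (1 - (Fintype.card E : ℝ)⁻¹) ^ t) := by
        rw [← Finset.sum_mul]
        exact mul_le_mul_of_nonneg_right hW (mul_nonneg hm0 hr)
    _ = _ := by ring

/-- Upper tail of a polynomial under the chain with constant rates. -/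
theorem glauber_const_pow_poly_upper [Nonempty E] {q : ℝ} (hq0 : 0 ≤ q) (hq1 : q ≤ 1)
    (t : ℕ) {w : ι → ℝ} (hw : ∀ i, 0 ≤ w i) {S : ι → Finset E} {m W B η l μ : ℝ}
    (hm : ∀ i, (#(S i) : ℝ) ≤ m) (hm0 : 0 ≤ m) (hW : ∑ i, w i ≤ W)
    (hB0 : 0 ≤ B) (hB : ∀ e, ∑ i, (if e ∈ S i then w i else 0) ≤ B)
    (hl : 0 ≤ l) (hlB : l * B ≤ 1) (hlv : l * (m * W * B) ≤ η / 4)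
    (ht : m * W * (1 - (Fintype.card E : ℝ)⁻¹) ^ t ≤ η / 2) (hμ : ∑ i, w i * q ^ #(S i) ≤ μ)
    (x : E → Bool) :
    (glauber (fun _ _ => q) ^ t) ({y | μ + η < poly w S y}.indicator 1) x ≤
      Real.exp (-(l * η / 4)) := by
  have h1 := abs_glauber_const_pow_poly_sub_le hq0 hq1 t hw hm hm0 hW x
  have h2 := glauber_const_pow_indicator_le hq0 hq1 t (f := poly w S) (m := μ + η / 2)
    (η := η / 2) hl (fun e => (mul_le_mul_of_nonneg_left (hB e) hl).trans hlB)
    (abs_poly_update_sub_le hw S) (sum_sq_influence_le hw hm hm0 hW hB0 hB) (x := x)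
    (by linarith [(abs_le.mp h1).2])
  rw [add_assoc, add_halves] at h2
  exact h2.trans (Real.exp_le_exp.mpr (by nlinarith))

/-- Lower tail of a polynomial under the chain with constant rates. -/
theorem glauber_const_pow_poly_lower [Nonempty E] {q : ℝ} (hq0 : 0 ≤ q) (hq1 : q ≤ 1)
    (t : ℕ) {w : ι → ℝ} (hw : ∀ i, 0 ≤ w i) {S : ι → Finset E} {m W B η l μ : ℝ}
    (hm : ∀ i, (#(S i) : ℝ) ≤ m) (hm0 : 0 ≤ m) (hW : ∑ i, w i ≤ W)
    (hB0 : 0 ≤ B) (hB : ∀ e, ∑ i, (if e ∈ S i then w i else 0) ≤ B)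
    (hl : 0 ≤ l) (hlB : l * B ≤ 1) (hlv : l * (m * W * B) ≤ η / 4)
    (ht : m * W * (1 - (Fintype.card E : ℝ)⁻¹) ^ t ≤ η / 2) (hμ : μ ≤ ∑ i, w i * q ^ #(S i))
    (x : E → Bool) :
    (glauber (fun _ _ => q) ^ t) ({y | poly w S y < μ - η}.indicator 1) x ≤
      Real.exp (-(l * η / 4)) := by
  have h1 := abs_glauber_const_pow_poly_sub_le hq0 hq1 t hw hm hm0 hW x
  have h2 := glauber_const_pow_indicator_le hq0 hq1 t (f := -poly w S) (m := -μ + η / 2)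
    (η := η / 2) hl (fun e => (mul_le_mul_of_nonneg_left (hB e) hl).trans hlB)
    (fun y e => by
      have := abs_poly_update_sub_le hw S y e
      rwa [← abs_neg, neg_sub, ← neg_sub_neg] at this)
    (sum_sq_influence_le hw hm hm0 hW hB0 hB) (x := x)
    (by rw [map_neg, Pi.neg_apply]; linarith [(abs_le.mp h1).1])
  have h3 : {y | -μ + η / 2 + η / 2 < (-poly w S) y} = {y | poly w S y < μ - η} := by
    ext y
    simp only [Set.mem_ofPred_eq, Pi.neg_apply]
    constructor <;> intro h <;> linarith
  rw [h3] at h2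
  exact h2.trans (Real.exp_le_exp.mpr (by nlinarith))

end Polynomials

section Derivatives

variable {E : Type*} [Fintype E] [DecidableEq E] {ι : Type*} [Fintype ι]

/-- The weights of the polynomial `∂_e (poly w S)`. -/
noncomputable def dWeight (w : ι → ℝ) (S : ι → Finset E) (e : E) (i : ι) : ℝ :=
  if e ∈ S i then w i else 0

/-- The weights of the polynomial `∑ f, ∂_f ∂_e (poly w S)`. -/
noncomputable def ddWeight (w : ι → ℝ) (S : ι → Finset E) (e : E) (i : ι × E) : ℝ :=
  if i.2 ∈ (S i.1).erase e then dWeight w S e i.1 else 0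

/-- The monomials of the polynomial `∑ f, ∂_f ∂_e (poly w S)`. -/
def ddSupport (S : ι → Finset E) (e : E) (i : ι × E) : Finset E :=
  ((S i.1).erase e).erase i.2

variable {w : ι → ℝ} {S : ι → Finset E}

omit [Fintype E] [Fintype ι] in
theorem dWeight_nonneg (hw : ∀ i, 0 ≤ w i) (e : E) (i : ι) : 0 ≤ dWeight w S e i := by
  unfold dWeight; split_ifs <;> simp [hw]

omit [Fintype E] [Fintype ι] in
theorem ddWeight_nonneg (hw : ∀ i, 0 ≤ w i) (e : E) (i : ι × E) : 0 ≤ ddWeight w S e i := by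
  unfold ddWeight; split_ifs <;> simp [dWeight_nonneg hw]

omit [Fintype E] in
theorem dWeight_influence_le (hw : ∀ i, 0 ≤ w i) {B : ℝ} (hB0 : 0 ≤ B)
    (hB : ∀ e f, e ≠ f → ∑ i, (if e ∈ S i ∧ f ∈ S i then w i else 0) ≤ B) (e f : E) :
    ∑ i, (if f ∈ (S i).erase e then dWeight w S e i else 0) ≤ B := by
  by_cases h : e = f
  · subst h; simpa using hB0
  · refine le_trans (Finset.sum_le_sum fun i _ => ?_) (hB e f h)
    unfold dWeight
    simp only [Finset.mem_erase]
    split_ifs with h1 h2 h3 h3 <;> first | exact le_rfl | exact hw i | tauto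

theorem sum_ddWeight_mul (e : E) (F : ι → ℝ) :
    ∑ i, ddWeight w S e i * F i.1 = ∑ i, dWeight w S e i * F i * #((S i).erase e) := by
  rw [Fintype.sum_prod_type]
  refine Finset.sum_congr rfl fun i _ => ?_
  simp only [ddWeight, ite_mul, zero_mul]
  rw [Finset.sum_ite_mem, Finset.univ_inter, Finset.sum_const, nsmul_eq_mul, mul_comm]

theorem sum_ddWeight_le (hw : ∀ i, 0 ≤ w i) {m W : ℝ} (hm : ∀ i, (#(S i) : ℝ) ≤ m) (hm0 : 0 ≤ m)
    {e : E} (hW : ∑ i, dWeight w S e i ≤ W) : ∑ i, ddWeight w S e i ≤ m * W := by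
  have h := sum_ddWeight_mul (w := w) (S := S) e (fun _ => 1)
  simp only [mul_one] at h
  rw [h]
  calc _ ≤ ∑ i, dWeight w S e i * m := Finset.sum_le_sum fun i _ =>
        mul_le_mul_of_nonneg_left
          ((Nat.cast_le.mpr (Finset.card_erase_le)).trans (hm i)) (dWeight_nonneg hw e i)
    _ ≤ m * W := by
        rw [← Finset.sum_mul, mul_comm]; exact mul_le_mul_of_nonneg_left hW hm0

theorem ddWeight_influence_le (hw : ∀ i, 0 ≤ w i) {m B : ℝ} (hm : ∀ i, (#(S i) : ℝ) ≤ m)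
    (hm0 : 0 ≤ m) (hB0 : 0 ≤ B)
    (hB : ∀ e f, e ≠ f → ∑ i, (if e ∈ S i ∧ f ∈ S i then w i else 0) ≤ B) (e f : E) :
    ∑ i, (if f ∈ ddSupport S e i then ddWeight w S e i else 0) ≤ m * B := by
  have h := sum_ddWeight_mul (w := w) (S := S) e (fun i => if f ∈ (S i).erase e then 1 else 0)
  calc _ ≤ ∑ i, ddWeight w S e i * (if f ∈ (S i.1).erase e then 1 else 0) := by
        refine Finset.sum_le_sum fun i _ => ?_
        by_cases h1 : f ∈ ddSupport S e i
        · rw [if_pos h1, if_pos (Finset.mem_of_mem_erase h1), mul_one]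
        · rw [if_neg h1]
          exact mul_nonneg (ddWeight_nonneg hw e i) (by split_ifs <;> norm_num)
    _ ≤ ∑ i, (if f ∈ (S i).erase e then dWeight w S e i else 0) * m := by
        rw [h]
        refine Finset.sum_le_sum fun i _ => ?_
        have h2 : dWeight w S e i * (if f ∈ (S i).erase e then 1 else 0) =
          if f ∈ (S i).erase e then dWeight w S e i else 0 := by split_ifs <;> simp
        rw [h2]
        refine mul_le_mul_of_nonneg_left
          ((Nat.cast_le.mpr (Finset.card_erase_le)).trans (hm i)) ?_
        split_ifs <;> simp [dWeight_nonneg hw]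
    _ ≤ m * B := by
        rw [← Finset.sum_mul, mul_comm]
        exact mul_le_mul_of_nonneg_left (dWeight_influence_le hw hB0 hB e f) hm0

theorem sum_poly_dWeight_update_sub (x : E → Bool) (e : E) :
    ∑ f, (poly (dWeight w S f) (fun i => (S i).erase f) (Function.update x e true) -
      poly (dWeight w S f) (fun i => (S i).erase f) (Function.update x e false)) =
      poly (ddWeight w S e) (ddSupport S e) x := by
  simp only [poly_update_sub]
  unfold poly
  rw [Fintype.sum_prod_type, Finset.sum_comm]
  refine Finset.sum_congr rfl fun i _ => Finset.sum_congr rfl fun f _ => ?_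
  unfold ddWeight ddSupport dWeight
  rw [Finset.erase_right_comm]
  congr 1
  simp only [Finset.mem_erase]
  by_cases hef : e = f
  · subst hef; simp
  · have : f ≠ e := Ne.symm hef
    by_cases h1 : e ∈ S i <;> by_cases h2 : f ∈ S i <;> simp [h1, h2, hef, this]

end Derivatives

section Copies

open scoped Classical in
/-- The edge set of the copy of `G` in `K_n` given by the injection `ψ`. -/
noncomputable def copyEdges {n m : ℕ} (G : SimpleGraph (Fin m)) (ψ : Fin m ↪ Fin n) :
    Finset (EdgeSet n) :=
  {e | ∃ a b, G.Adj a b ∧ s(ψ a, ψ b) = e.1}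

theorem mem_copyEdges {n m : ℕ} {G : SimpleGraph (Fin m)} {ψ : Fin m ↪ Fin n} {e : EdgeSet n} :
    e ∈ copyEdges G ψ ↔ ∃ a b, G.Adj a b ∧ s(ψ a, ψ b) = e.1 := by
  simp [copyEdges]

theorem card_copyEdges {n m : ℕ} (G : SimpleGraph (Fin m)) (ψ : Fin m ↪ Fin n) :
    #(copyEdges G ψ) = numEdges G := by
  unfold numEdges
  rw [← Set.ncard_image_of_injective G.edgeSet (Sym2.map.injective ψ.injective),
    ← Set.ncard_coe_finset, ← Set.ncard_image_of_injective _ Subtype.val_injective]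
  congr 1
  ext p
  simp only [Set.mem_image, Finset.mem_coe, mem_copyEdges]
  constructor
  · rintro ⟨e, ⟨a, b, hab, he⟩, rfl⟩
    exact ⟨s(a, b), hab, he⟩
  · rintro ⟨q, hq, rfl⟩
    induction q with
    | _ a b =>
      have hab : G.Adj a b := hq
      have hd : ¬ (s(ψ a, ψ b)).IsDiag := by
        rw [Sym2.mk_isDiag_iff]; exact fun h => hab.ne (ψ.injective h)
      exact ⟨⟨s(ψ a, ψ b), hd⟩, ⟨a, b, hab, rfl⟩, rfl⟩

theorem NG_eq_sum_mono {n m : ℕ} (G : SimpleGraph (Fin m)) (x : Config n) :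
    NG G x = ∑ ψ, mono (copyEdges G ψ) x := by
  classical
  unfold NG
  refine Finset.sum_congr rfl fun ψ _ => ?_
  have hd : ∀ a b, G.Adj a b → ¬ (s(ψ a, ψ b)).IsDiag := fun a b hab => by
    rw [Sym2.mk_isDiag_iff]; exact fun h => hab.ne (ψ.injective h)
  by_cases h : ∀ e ∈ copyEdges G ψ, x e = true
  · rw [mono, if_pos h]
    refine Finset.prod_eq_one fun a _ => Finset.prod_eq_one fun b _ => ?_
    split_ifs with hab
    · have := h ⟨s(ψ a, ψ b), hd a b hab⟩ (mem_copyEdges.mpr ⟨a, b, hab, rfl⟩)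
      simp only [edgeInd, edgeVal, dif_neg (hd a b hab), this, if_true]
    · rfl
  · rw [mono, if_neg h]
    push Not at h
    obtain ⟨⟨e, he⟩, hmem, hx⟩ := h
    obtain ⟨a, b, hab, rfl⟩ := mem_copyEdges.mp hmem
    refine Finset.prod_eq_zero (Finset.mem_univ a) (Finset.prod_eq_zero (Finset.mem_univ b) ?_)
    rw [if_pos hab]
    simp only [edgeInd, edgeVal, dif_neg he]
    rw [if_neg hx]

theorem card_embedding_extending_le {n m : ℕ} (A : Finset (Fin m)) (g : Fin m → Fin n) :
    #{ψ : Fin m ↪ Fin n | ∀ a ∈ A, ψ a = g a} ≤ n ^ (m - #A) := by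
  classical
  have h1 : Fintype.card ({a // a ∉ A} → Fin n) = n ^ (m - #A) := by
    rw [Fintype.card_fun, Fintype.card_fin, Fintype.card_subtype_compl, Fintype.card_fin,
      Fintype.card_coe]
  rw [← h1, ← Finset.card_univ]
  refine Finset.card_le_card_of_injOn (fun ψ a => ψ a.1) (fun _ _ => Finset.mem_univ _) ?_
  intro ψ hψ ψ' hψ' h
  simp only [Finset.coe_filter, Finset.mem_univ, true_and, Set.mem_ofPred_eq] at hψ hψ'
  ext a
  by_cases ha : a ∈ A
  · rw [hψ a ha, hψ' a ha]
  · exact congrArg Fin.val (congrFun h ⟨a, ha⟩)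

open scoped Classical in
theorem card_copies_through_pair_mul_le {n m : ℕ} (G : SimpleGraph (Fin m)) {e f : EdgeSet n}
    (hef : e ≠ f) :
    #{ψ : Fin m ↪ Fin n | e ∈ copyEdges G ψ ∧ f ∈ copyEdges G ψ} * n ≤ m ^ 3 * n ^ (m - 2) := by
  obtain ⟨⟨u, v⟩, he⟩ := e
  obtain ⟨⟨u', v'⟩, hf⟩ := f
  have huv : u ≠ v := he
  have huv' : u' ≠ v' := hf
  obtain ⟨w, hw, hwu, hwv⟩ : ∃ w, (w = u' ∨ w = v') ∧ w ≠ u ∧ w ≠ v := by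
    by_contra! hcon
    apply hef
    apply Subtype.ext
    change s(u, v) = s(u', v')
    rw [Sym2.eq_iff]
    by_cases h1 : u' = u
    · have h2 := hcon v' (Or.inr rfl) (by rintro rfl; exact huv' h1)
      exact Or.inl ⟨h1.symm, h2.symm⟩
    · have h2 := hcon u' (Or.inl rfl) h1
      have h3 : v' = u := by
        by_contra h4
        exact huv' (h2.trans (hcon v' (Or.inr rfl) h4).symm)
      exact Or.inr ⟨h3.symm, h2.symm⟩
  let T : Finset (Fin m × Fin m × Fin m) :=
    {p | p.1 ≠ p.2.1 ∧ p.1 ≠ p.2.2 ∧ p.2.1 ≠ p.2.2}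
  have hsub : ({ψ : Fin m ↪ Fin n | (⟨s(u, v), he⟩ : EdgeSet n) ∈ copyEdges G ψ ∧
      (⟨s(u', v'), hf⟩ : EdgeSet n) ∈ copyEdges G ψ} : Finset _) ⊆
      T.biUnion fun p => {ψ | ψ p.1 = u ∧ ψ p.2.1 = v ∧ ψ p.2.2 = w} := by
    intro ψ hψ
    simp only [Finset.mem_filter, Finset.mem_univ, true_and, mem_copyEdges] at hψ
    obtain ⟨⟨a, b, -, hab⟩, a', b', -, hab'⟩ := hψ
    have h1 : ∃ a b, ψ a = u ∧ ψ b = v := by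
      rcases Sym2.eq_iff.mp hab with h | h
      · exact ⟨a, b, h⟩
      · exact ⟨b, a, h.2, h.1⟩
    have h2 : ∃ c, ψ c = w := by
      rcases Sym2.eq_iff.mp hab' with h | h <;> rcases hw with rfl | rfl
      · exact ⟨_, h.1⟩
      · exact ⟨_, h.2⟩
      · exact ⟨_, h.2⟩
      · exact ⟨_, h.1⟩
    obtain ⟨a, b, ha, hb⟩ := h1
    obtain ⟨c, hc⟩ := h2
    simp only [Finset.mem_biUnion, Finset.mem_filter, Finset.mem_univ, true_and, T]
    refine ⟨(a, b, c), ⟨?_, ?_, ?_⟩, ha, hb, hc⟩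
    · exact fun h => huv (by rw [← ha, ← hb]; exact congrArg ψ h)
    · exact fun h => hwu (by rw [← ha, ← hc]; exact congrArg ψ h.symm)
    · exact fun h => hwv (by rw [← hb, ← hc]; exact congrArg ψ h.symm)
  have hcard : ∀ p ∈ T, #{ψ : Fin m ↪ Fin n | ψ p.1 = u ∧ ψ p.2.1 = v ∧ ψ p.2.2 = w} * n ≤
      n ^ (m - 2) := by
    rintro ⟨a, b, c⟩ hp
    simp only [Finset.mem_filter, Finset.mem_univ, true_and, T] at hp
    obtain ⟨hab, hac, hbc⟩ := hp
    have hA : #({a, b, c} : Finset (Fin m)) = 3 :=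
      Finset.card_eq_three.mpr ⟨a, b, c, hab, hac, hbc, rfl⟩
    have hm : 3 ≤ m := by
      have := Finset.card_le_univ ({a, b, c} : Finset (Fin m))
      rwa [hA, Fintype.card_fin] at this
    have h3 := card_embedding_extending_le (n := n) {a, b, c}
      (fun d => if d = a then u else if d = b then v else w)
    rw [hA] at h3
    have h4 : n ^ (m - 2) = n ^ (m - 3) * n := by rw [← pow_succ]; congr 1; omega
    rw [h4]
    refine Nat.mul_le_mul_right n (le_trans (Finset.card_le_card ?_) h3)
    intro ψ hψ
    simp only [Finset.mem_filter, Finset.mem_univ, true_and] at hψ ⊢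
    intro d hd
    simp only [Finset.mem_insert, Finset.mem_singleton] at hd
    rcases hd with rfl | rfl | rfl
    · simp [hψ.1]
    · simp [hab.symm, hψ.2.1]
    · simp [hac.symm, hbc.symm, hψ.2.2]
  calc _ ≤ (∑ p ∈ T, #{ψ : Fin m ↪ Fin n | ψ p.1 = u ∧ ψ p.2.1 = v ∧ ψ p.2.2 = w}) * n :=
        Nat.mul_le_mul_right n ((Finset.card_le_card hsub).trans Finset.card_biUnion_le)
    _ ≤ ∑ p ∈ T, n ^ (m - 2) := by
        rw [Finset.sum_mul]; exact Finset.sum_le_sum hcard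
    _ ≤ m ^ 3 * n ^ (m - 2) := by
        rw [Finset.sum_const, smul_eq_mul]
        refine Nat.mul_le_mul_right _ ((Finset.card_le_univ T).trans (le_of_eq ?_))
        simp only [Fintype.card_prod, Fintype.card_fin]; ring

open scoped Classical in
theorem card_copies_through_eq {n m : ℕ} (G : SimpleGraph (Fin m)) (e f : EdgeSet n) :
    #{ψ : Fin m ↪ Fin n | e ∈ copyEdges G ψ} = #{ψ : Fin m ↪ Fin n | f ∈ copyEdges G ψ} := by
  suffices h : ∀ e f : EdgeSet n, #{ψ : Fin m ↪ Fin n | e ∈ copyEdges G ψ} ≤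
      #{ψ : Fin m ↪ Fin n | f ∈ copyEdges G ψ} from le_antisymm (h e f) (h f e)
  rintro ⟨⟨u, v⟩, he⟩ ⟨⟨u', v'⟩, hf⟩
  have huv : u ≠ v := he
  have huv' : u' ≠ v' := hf
  let σ : Equiv.Perm (Fin n) :=
    (Equiv.swap u u').trans (Equiv.swap (Equiv.swap u u' v) v')
  have h1 : σ u = u' := by
    have h2 : u' ≠ Equiv.swap u u' v := fun h =>
      huv ((Equiv.swap u u').injective (by rw [← h, Equiv.swap_apply_left]))
    simp only [σ, Equiv.trans_apply, Equiv.swap_apply_left]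
    exact Equiv.swap_apply_of_ne_of_ne h2 huv'
  have h2 : σ v = v' := by simp [σ]
  refine Finset.card_le_card_of_injOn (fun ψ => ψ.trans σ.toEmbedding) ?_ ?_
  · intro ψ hψ
    simp only [Finset.coe_filter, Finset.mem_univ, true_and, Set.mem_ofPred_eq,
      mem_copyEdges] at hψ ⊢
    obtain ⟨a, b, hab, h⟩ := hψ
    refine ⟨a, b, hab, ?_⟩
    have h' : s(ψ a, ψ b) = s(u, v) := h
    have h3 := congrArg (Sym2.map σ) h'
    rw [Sym2.map_mk, Sym2.map_mk, h1, h2] at h3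
    exact h3
  · intro ψ _ ψ' _ h
    ext a
    have := congrArg (fun g : Fin m ↪ Fin n => g a) h
    exact congrArg Fin.val (σ.injective this)

theorem card_edgeSet (n : ℕ) : Fintype.card (EdgeSet n) = n.choose 2 := by
  rw [Sym2.card_subtype_not_diag, Fintype.card_fin]

theorem two_mul_card_edgeSet (n : ℕ) : 2 * Fintype.card (EdgeSet n) = n * (n - 1) := by
  rw [card_edgeSet, Nat.choose_two_right, Nat.mul_div_cancel' (Nat.even_mul_pred_self n).two_dvd]

open scoped Classical in
theorem card_copies_through_mul {n m : ℕ} (G : SimpleGraph (Fin m)) (e : EdgeSet n) :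
    #{ψ : Fin m ↪ Fin n | e ∈ copyEdges G ψ} * Fintype.card (EdgeSet n) =
      numEdges G * n.descFactorial m := by
  have h1 : ∑ f : EdgeSet n, #{ψ : Fin m ↪ Fin n | f ∈ copyEdges G ψ} =
      ∑ ψ : Fin m ↪ Fin n, #(copyEdges G ψ) := by
    simp only [Finset.card_eq_sum_ones, Finset.sum_filter]
    rw [Finset.sum_comm]
    refine Finset.sum_congr rfl fun ψ _ => ?_
    rw [Finset.sum_ite_mem, Finset.univ_inter]
  rw [Finset.sum_congr rfl fun f _ => card_copies_through_eq G f e] at h1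
  simp only [card_copyEdges, Finset.sum_const, Finset.card_univ, smul_eq_mul,
    Fintype.card_embedding_eq, Fintype.card_fin] at h1
  rw [mul_comm, h1, mul_comm]

theorem two_le_of_numEdges_ne_zero {m : ℕ} {G : SimpleGraph (Fin m)} (h : numEdges G ≠ 0) :
    2 ≤ m := by
  obtain ⟨e, he⟩ := Set.nonempty_of_ncard_ne_zero h
  induction e with
  | _ a b =>
    have hab : G.Adj a b := he
    have := hab.ne
    by_contra hm
    exact this (Fin.ext (by omega))

open scoped Classical in
theorem card_copies_through_le {n m : ℕ} (G : SimpleGraph (Fin m)) (e : EdgeSet n) :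
    #{ψ : Fin m ↪ Fin n | e ∈ copyEdges G ψ} ≤ 2 * numEdges G * n ^ (m - 2) := by
  have hM : 0 < Fintype.card (EdgeSet n) := Fintype.card_pos_iff.mpr ⟨e⟩
  have h := card_copies_through_mul G e
  by_cases h0 : numEdges G = 0
  · rw [h0, zero_mul] at h
    rw [h0]
    rcases Nat.mul_eq_zero.mp h with h | h <;> omega
  obtain ⟨k, rfl⟩ := Nat.exists_eq_add_of_le' (two_le_of_numEdges_ne_zero h0)
  refine Nat.le_of_mul_le_mul_right ?_ hM
  rw [h]
  have h2 : n.descFactorial (k + 2) ≤ n * (n - 1) * n ^ k := by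
    rcases n with _ | _ | n
    · simp
    · simp
    · rw [Nat.succ_descFactorial_succ, Nat.succ_descFactorial_succ, ← mul_assoc]
      refine Nat.mul_le_mul_left _ ((Nat.descFactorial_le_pow n k).trans ?_)
      exact Nat.pow_le_pow_left (by omega) k
  rw [← two_mul_card_edgeSet] at h2
  calc _ ≤ numEdges G * (2 * Fintype.card (EdgeSet n) * n ^ k) := Nat.mul_le_mul_left _ h2
    _ = _ := by rw [Nat.add_sub_cancel]; ring

open scoped Classical in
theorem eventually_le_card_copies_through {m : ℕ} (G : SimpleGraph (Fin m)) {η : ℝ} (hη : 0 < η) :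
    ∀ᶠ n : ℕ in atTop, ∀ e : EdgeSet n, (2 * numEdges G - η) * (n : ℝ) ^ (m - 2) ≤
      #{ψ : Fin m ↪ Fin n | e ∈ copyEdges G ψ} := by
  by_cases h0 : numEdges G = 0
  · refine Filter.Eventually.of_forall fun n e => ?_
    have : (2 * (numEdges G : ℝ) - η) * (n : ℝ) ^ (m - 2) ≤ 0 :=
      mul_nonpos_of_nonpos_of_nonneg (by rw [h0]; simp; exact hη.le) (by positivity)
    exact this.trans (Nat.cast_nonneg _)
  obtain ⟨k, rfl⟩ := Nat.exists_eq_add_of_le' (two_le_of_numEdges_ne_zero h0)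
  have hlim : Tendsto (fun n : ℕ => 2 * (numEdges G : ℝ) * (1 - ((k + 1 : ℕ) : ℝ) / n) ^ (k + 2))
      atTop (nhds (2 * numEdges G * (1 - 0) ^ (k + 2))) :=
    ((tendsto_const_nhds.sub (tendsto_const_div_atTop_nhds_zero_nat _)).pow _).const_mul _
  have hev := hlim.eventually (lt_mem_nhds (a := 2 * (numEdges G : ℝ) - η) (by simp [hη]))
  filter_upwards [hev, eventually_ge_atTop (k + 2)] with n hn hnk e
  have hM : 0 < Fintype.card (EdgeSet n) := Fintype.card_pos_iff.mpr ⟨e⟩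
  have hMr : (0 : ℝ) < Fintype.card (EdgeSet n) := Nat.cast_pos.mpr hM
  have hn0 : (0 : ℝ) < n := Nat.cast_pos.mpr (by omega)
  have h := card_copies_through_mul G e
  have h1 : (n - (k + 1)) ^ (k + 2) ≤ n.descFactorial (k + 2) := by
    have := Nat.pow_sub_le_descFactorial n (k + 2)
    rwa [show n + 1 - (k + 2) = n - (k + 1) by omega] at this
  have h1r : ((n : ℝ) - (k + 1 : ℕ)) ^ (k + 2) ≤ n.descFactorial (k + 2) := by
    rw [← Nat.cast_sub (by omega)]; exact_mod_cast h1
  have hr : (#{ψ : Fin (k + 2) ↪ Fin n | e ∈ copyEdges G ψ} : ℝ) * Fintype.card (EdgeSet n) =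
      numEdges G * n.descFactorial (k + 2) := by exact_mod_cast h
  have h2 : 2 * (Fintype.card (EdgeSet n) : ℝ) ≤ n ^ 2 := by
    have : 2 * Fintype.card (EdgeSet n) ≤ n ^ 2 := by
      rw [two_mul_card_edgeSet, sq]; exact Nat.mul_le_mul_left _ (Nat.sub_le _ _)
    exact_mod_cast this
  refine le_of_mul_le_mul_right ?_ hMr
  rw [hr, Nat.add_sub_cancel]
  calc (2 * (numEdges G : ℝ) - η) * (n : ℝ) ^ k * Fintype.card (EdgeSet n)
      ≤ 2 * (numEdges G : ℝ) * (1 - ((k + 1 : ℕ) : ℝ) / n) ^ (k + 2) * (n : ℝ) ^ k *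
        Fintype.card (EdgeSet n) := by gcongr
    _ = numEdges G * (1 - ((k + 1 : ℕ) : ℝ) / n) ^ (k + 2) * (n : ℝ) ^ k *
        (2 * Fintype.card (EdgeSet n)) := by ring
    _ ≤ numEdges G * (1 - ((k + 1 : ℕ) : ℝ) / n) ^ (k + 2) * (n : ℝ) ^ k * n ^ 2 := by
        have : 0 ≤ 1 - ((k + 1 : ℕ) : ℝ) / n := by
          rw [sub_nonneg, div_le_one hn0]; exact_mod_cast (by omega : k + 1 ≤ n)
        gcongr
    _ = numEdges G * ((n : ℝ) - (k + 1 : ℕ)) ^ (k + 2) := by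
        have : (n : ℝ) - (k + 1 : ℕ) = (1 - ((k + 1 : ℕ) : ℝ) / n) * n := by field_simp
        rw [this, mul_pow]; ring
    _ ≤ _ := by gcongr

end Copies

section Logistic

theorem Phi_eq_sigmoid : Phi = Real.sigmoid := by
  funext u
  rw [Phi, Real.sigmoid_def, Real.exp_neg]
  have := Real.exp_pos u
  field_simp
  ring

theorem Phi_pos (u : ℝ) : 0 < Phi u := by rw [Phi_eq_sigmoid]; exact Real.sigmoid_pos u

theorem Phi_lt_one (u : ℝ) : Phi u < 1 := by rw [Phi_eq_sigmoid]; exact Real.sigmoid_lt_one u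

theorem Phi_monotone : Monotone Phi := by rw [Phi_eq_sigmoid]; exact Real.sigmoid_monotone

theorem continuous_Phi : Continuous Phi := by rw [Phi_eq_sigmoid]; exact continuous_sigmoid

theorem hasDerivAt_Phi (u : ℝ) : HasDerivAt Phi (Phi u * (1 - Phi u)) u := by
  rw [Phi_eq_sigmoid]; exact Real.hasDerivAt_sigmoid u

end Logistic

section Polynomial

variable {s : ℕ} (V : Fin s → ℕ) (G : ∀ i, SimpleGraph (Fin (V i))) (β : Fin s → ℝ)

/-- The copies in `K_n` of the graphs defining the model. -/
abbrev Copies (n : ℕ) : Type := Σ i, (Fin (V i) ↪ Fin n)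

/-- The weight of a copy in the Hamiltonian. -/
noncomputable def copyWeight (n : ℕ) (ω : Copies V n) : ℝ := β ω.1 / (n : ℝ) ^ (V ω.1 - 2)

/-- The edges of a copy. -/
noncomputable def copySupport (n : ℕ) (ω : Copies V n) : Finset (EdgeSet n) :=
  copyEdges (G ω.1) ω.2

/-- `Ψ_β'(p)`. -/
noncomputable def dPsi (p : ℝ) : ℝ :=
  ∑ i, 2 * β i * (numEdges (G i) : ℝ) * (((numEdges (G i) - 1 : ℕ) : ℝ) *
    p ^ (numEdges (G i) - 1 - 1))

/-- The rates of the Glauber dynamics. -/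
noncomputable def ergmRate (n : ℕ) (e : EdgeSet n) (x : Config n) : ℝ := Phi (dHam V G β e x)

variable {V G β}

theorem copyWeight_nonneg (hβ : ∀ i, 0 ≤ β i) {n : ℕ} (ω : Copies V n) :
    0 ≤ copyWeight V β n ω := div_nonneg (hβ _) (by positivity)

theorem card_copySupport {n : ℕ} (ω : Copies V n) :
    #(copySupport V G n ω) = numEdges (G ω.1) := card_copyEdges _ _

theorem card_copySupport_le {n : ℕ} (ω : Copies V n) :
    (#(copySupport V G n ω) : ℝ) ≤ ∑ i, (numEdges (G i) : ℝ) := by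
  rw [card_copySupport]
  exact Finset.single_le_sum (f := fun i => (numEdges (G i) : ℝ))
    (fun i _ => Nat.cast_nonneg _) (Finset.mem_univ ω.1)

theorem Hamiltonian_eq_poly {n : ℕ} :
    Hamiltonian V G β = poly (copyWeight V β n) (copySupport V G n) := by
  funext x
  simp only [Hamiltonian, poly, Fintype.sum_sigma, NG_eq_sum_mono, copyWeight, copySupport,
    Finset.mul_sum, Finset.sum_div]
  exact Finset.sum_congr rfl fun i _ => Finset.sum_congr rfl fun ψ _ => by ring

theorem dHam_eq_poly {n : ℕ} (e : EdgeSet n) :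
    dHam V G β e = poly (dWeight (copyWeight V β n) (copySupport V G n) e)
      (fun ω => (copySupport V G n ω).erase e) := by
  funext x
  rw [dHam, Hamiltonian_eq_poly, poly_update_sub]
  rfl

theorem dHam_nonneg (hβ : ∀ i, 0 ≤ β i) {n : ℕ} (e : EdgeSet n) (x : Config n) :
    0 ≤ dHam V G β e x := by
  rw [dHam_eq_poly]; exact poly_nonneg (dWeight_nonneg (copyWeight_nonneg hβ) e) _ x

theorem dHam_monotone (hβ : ∀ i, 0 ≤ β i) {n : ℕ} (e : EdgeSet n) :
    Monotone (dHam V G β e) := by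
  rw [dHam_eq_poly]; exact poly_monotone (dWeight_nonneg (copyWeight_nonneg hβ) e) _

open scoped Classical in
theorem sum_dWeight_mul_eq {n : ℕ} (e : EdgeSet n) (F : Fin s → ℝ) :
    ∑ ω, dWeight (copyWeight V β n) (copySupport V G n) e ω * F ω.1 =
      ∑ i, β i * F i * (#{ψ : Fin (V i) ↪ Fin n | e ∈ copyEdges (G i) ψ} /
        (n : ℝ) ^ (V i - 2)) := by
  rw [Fintype.sum_sigma]
  refine Finset.sum_congr rfl fun i _ => ?_
  have h : ∀ ψ : Fin (V i) ↪ Fin n,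
      dWeight (copyWeight V β n) (copySupport V G n) e ⟨i, ψ⟩ * F i =
        if e ∈ copyEdges (G i) ψ then β i / (n : ℝ) ^ (V i - 2) * F i else 0 := fun ψ => by
    by_cases he : e ∈ copyEdges (G i) ψ <;> simp [dWeight, copyWeight, copySupport, he]
  rw [Finset.sum_congr rfl fun ψ _ => h ψ, ← Finset.sum_filter, Finset.sum_const, nsmul_eq_mul]
  ring

theorem sum_dWeight_mul_le (hβ : ∀ i, 0 ≤ β i) {n : ℕ} (e : EdgeSet n) {F : Fin s → ℝ}
    (hF : ∀ i, 0 ≤ F i) :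
    ∑ ω, dWeight (copyWeight V β n) (copySupport V G n) e ω * F ω.1 ≤
      ∑ i, 2 * β i * numEdges (G i) * F i := by
  classical
  have hn : (0 : ℝ) < n := by
    obtain ⟨⟨u, v⟩, _⟩ := e
    exact Nat.cast_pos.mpr (Nat.lt_of_le_of_lt (Nat.zero_le _) u.2)
  rw [sum_dWeight_mul_eq]
  refine Finset.sum_le_sum fun i _ => ?_
  have h : (#{ψ : Fin (V i) ↪ Fin n | e ∈ copyEdges (G i) ψ} : ℝ) ≤
      2 * numEdges (G i) * (n : ℝ) ^ (V i - 2) := by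
    exact_mod_cast card_copies_through_le (G i) e
  have h2 := (div_le_iff₀ (pow_pos hn (V i - 2))).mpr h
  calc _ ≤ β i * F i * (2 * numEdges (G i)) :=
        mul_le_mul_of_nonneg_left h2 (mul_nonneg (hβ i) (hF i))
    _ = _ := by ring

theorem eventually_le_sum_dWeight_mul (hβ : ∀ i, 0 ≤ β i) {η : ℝ} (hη : 0 < η) :
    ∀ᶠ n : ℕ in atTop, ∀ (e : EdgeSet n) (F : Fin s → ℝ), (∀ i, 0 ≤ F i) → (∀ i, F i ≤ 1) →
      ∑ i, 2 * β i * numEdges (G i) * F i - η ≤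
        ∑ ω, dWeight (copyWeight V β n) (copySupport V G n) e ω * F ω.1 := by
  classical
  set b := ∑ i, β i with hb
  have hb0 : 0 ≤ b := Finset.sum_nonneg fun i _ => hβ i
  have hη' : 0 < η / (b + 1) := by positivity
  have h : ∀ᶠ n : ℕ in atTop, ∀ i, ∀ e : EdgeSet n,
      (2 * (numEdges (G i) : ℝ) - η / (b + 1)) * (n : ℝ) ^ (V i - 2) ≤
        #{ψ : Fin (V i) ↪ Fin n | e ∈ copyEdges (G i) ψ} :=
    Filter.eventually_all.mpr fun i => eventually_le_card_copies_through (G i) hη'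
  filter_upwards [h, eventually_gt_atTop 0] with n hn hn0 e F hF0 hF1
  have hnr : (0 : ℝ) < n := Nat.cast_pos.mpr hn0
  rw [sum_dWeight_mul_eq]
  have h1 : ∑ i, β i * (η / (b + 1)) ≤ η := by
    rw [← Finset.sum_mul, ← hb, mul_div_assoc', div_le_iff₀ (by positivity)]
    nlinarith
  refine le_trans (sub_le_sub_left h1 _) ?_
  rw [← Finset.sum_sub_distrib]
  refine Finset.sum_le_sum fun i _ => ?_
  have h2 := (le_div_iff₀ (pow_pos hnr (V i - 2))).mpr (hn i e)
  calc _ ≤ β i * F i * (2 * (numEdges (G i) : ℝ) - η / (b + 1)) := by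
        nlinarith [mul_nonneg (mul_nonneg (hβ i) hη'.le) (sub_nonneg.mpr (hF1 i))]
    _ ≤ _ := mul_le_mul_of_nonneg_left h2 (mul_nonneg (hβ i) (hF0 i))

theorem sum_dWeight_le (hβ : ∀ i, 0 ≤ β i) {n : ℕ} (e : EdgeSet n) :
    ∑ ω, dWeight (copyWeight V β n) (copySupport V G n) e ω ≤ Psi V G β 1 := by
  have h := sum_dWeight_mul_le (G := G) hβ e (F := fun _ => 1) fun _ => zero_le_one
  simpa [Psi] using h

theorem dHam_le (hβ : ∀ i, 0 ≤ β i) {n : ℕ} (e : EdgeSet n) (x : Config n) :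
    dHam V G β e x ≤ Psi V G β 1 := by
  rw [dHam_eq_poly]
  exact (poly_le_sum (dWeight_nonneg (copyWeight_nonneg hβ) e) _ x).trans (sum_dWeight_le hβ e)

theorem dWeight_mul_pow {n : ℕ} (e : EdgeSet n) (q : ℝ) (ω : Copies V n) :
    dWeight (copyWeight V β n) (copySupport V G n) e ω * q ^ #((copySupport V G n ω).erase e) =
      dWeight (copyWeight V β n) (copySupport V G n) e ω * q ^ (numEdges (G ω.1) - 1) := by
  unfold dWeight
  split_ifs with h
  · rw [Finset.card_erase_of_mem h, card_copySupport]
  · simp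

theorem sum_dWeight_mul_pow_le (hβ : ∀ i, 0 ≤ β i) {n : ℕ} (e : EdgeSet n) {q : ℝ} (hq : 0 ≤ q) :
    ∑ ω, dWeight (copyWeight V β n) (copySupport V G n) e ω *
      q ^ #((copySupport V G n ω).erase e) ≤ Psi V G β q := by
  simp only [dWeight_mul_pow]
  exact sum_dWeight_mul_le (G := G) hβ e (F := fun i => q ^ (numEdges (G i) - 1))
    fun i => pow_nonneg hq _

theorem eventually_le_sum_dWeight_mul_pow (hβ : ∀ i, 0 ≤ β i) {η : ℝ} (hη : 0 < η) :
    ∀ᶠ n : ℕ in atTop, ∀ (e : EdgeSet n) (q : ℝ), 0 ≤ q → q ≤ 1 →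
      Psi V G β q - η ≤ ∑ ω, dWeight (copyWeight V β n) (copySupport V G n) e ω *
        q ^ #((copySupport V G n ω).erase e) := by
  filter_upwards [eventually_le_sum_dWeight_mul (G := G) hβ hη] with n hn e q hq0 hq1
  simp only [dWeight_mul_pow]
  exact hn e (fun i => q ^ (numEdges (G i) - 1)) (fun i => pow_nonneg hq0 _)
    fun i => pow_le_one₀ hq0 hq1

theorem sum_ddWeight_mul_pow_le (hβ : ∀ i, 0 ≤ β i) {n : ℕ} (e : EdgeSet n) {q : ℝ}
    (hq : 0 ≤ q) :
    ∑ ω, ddWeight (copyWeight V β n) (copySupport V G n) e ω *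
      q ^ #(ddSupport (copySupport V G n) e ω) ≤ dPsi V G β q := by
  have h1 : ∀ ω, ddWeight (copyWeight V β n) (copySupport V G n) e ω *
      q ^ #(ddSupport (copySupport V G n) e ω) =
      ddWeight (copyWeight V β n) (copySupport V G n) e ω *
        q ^ (numEdges (G ω.1.1) - 1 - 1) := by
    intro ω
    unfold ddWeight ddSupport dWeight
    split_ifs with h h'
    · rw [Finset.card_erase_of_mem h, Finset.card_erase_of_mem h', card_copySupport]
    · simp
    · simp
  have h2 := sum_ddWeight_mul (w := copyWeight V β n) (S := copySupport V G n) e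
    (fun ω => q ^ (numEdges (G ω.1) - 1 - 1))
  rw [Finset.sum_congr rfl fun ω _ => h1 ω, h2]
  have h3 : ∀ ω, dWeight (copyWeight V β n) (copySupport V G n) e ω *
      q ^ (numEdges (G ω.1) - 1 - 1) * #((copySupport V G n ω).erase e) =
      dWeight (copyWeight V β n) (copySupport V G n) e ω *
        (((numEdges (G ω.1) - 1 : ℕ) : ℝ) * q ^ (numEdges (G ω.1) - 1 - 1)) := by
    intro ω
    unfold dWeight
    split_ifs with h
    · rw [Finset.card_erase_of_mem h, card_copySupport]; ring
    · simp
  rw [Finset.sum_congr rfl fun ω _ => h3 ω]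
  exact sum_dWeight_mul_le (G := G) hβ e
    (F := fun i => ((numEdges (G i) - 1 : ℕ) : ℝ) * q ^ (numEdges (G i) - 1 - 1))
    fun i => by positivity

theorem sum_copyWeight_pair_le (hβ : ∀ i, 0 ≤ β i) {n : ℕ} {e f : EdgeSet n} (hef : e ≠ f) :
    ∑ ω, (if e ∈ copySupport V G n ω ∧ f ∈ copySupport V G n ω then copyWeight V β n ω else 0) ≤
      (∑ i, β i * (V i : ℝ) ^ 3) / n := by
  classical
  have hn : (0 : ℝ) < n := by
    obtain ⟨⟨u, v⟩, _⟩ := e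
    exact Nat.cast_pos.mpr (Nat.lt_of_le_of_lt (Nat.zero_le _) u.2)
  rw [Fintype.sum_sigma, Finset.sum_div]
  refine Finset.sum_le_sum fun i _ => ?_
  have h' : ∀ ψ : Fin (V i) ↪ Fin n,
      (if e ∈ copySupport V G n ⟨i, ψ⟩ ∧ f ∈ copySupport V G n ⟨i, ψ⟩ then
        copyWeight V β n ⟨i, ψ⟩ else 0) =
      if e ∈ copyEdges (G i) ψ ∧ f ∈ copyEdges (G i) ψ then β i / (n : ℝ) ^ (V i - 2) else 0 :=
    fun ψ => by
      by_cases he : e ∈ copyEdges (G i) ψ ∧ f ∈ copyEdges (G i) ψ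
      · exact (if_pos he).trans (if_pos he).symm
      · exact (if_neg he).trans (if_neg he).symm
  rw [Finset.sum_congr rfl fun ψ _ => h' ψ, ← Finset.sum_filter, Finset.sum_const, nsmul_eq_mul]
  have h : (#{ψ : Fin (V i) ↪ Fin n | e ∈ copyEdges (G i) ψ ∧ f ∈ copyEdges (G i) ψ} : ℝ) * n ≤
      (V i : ℝ) ^ 3 * (n : ℝ) ^ (V i - 2) := by
    exact_mod_cast card_copies_through_pair_mul_le (G i) hef
  rw [le_div_iff₀ hn, mul_div_assoc', div_mul_eq_mul_div, div_le_iff₀ (by positivity)]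
  nlinarith [mul_le_mul_of_nonneg_left h (hβ i)]

theorem hasDerivAt_Psi (p : ℝ) : HasDerivAt (Psi V G β) (dPsi V G β p) p := by
  unfold Psi dPsi
  exact HasDerivAt.fun_sum fun i _ => (hasDerivAt_pow _ p).const_mul _

theorem continuous_Psi : Continuous (Psi V G β) := by
  unfold Psi; fun_prop

theorem continuous_dPsi : Continuous (dPsi V G β) := by
  unfold dPsi; fun_prop

theorem Psi_monotoneOn (hβ : ∀ i, 0 ≤ β i) : MonotoneOn (Psi V G β) (Set.Ici 0) := by
  intro p hp q _ hpq
  refine Finset.sum_le_sum fun i _ => mul_le_mul_of_nonneg_left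
    (pow_le_pow_left₀ hp hpq _) ?_
  have := hβ i
  positivity

theorem Psi_nonneg (hβ : ∀ i, 0 ≤ β i) {p : ℝ} (hp : 0 ≤ p) : 0 ≤ Psi V G β p :=
  Finset.sum_nonneg fun i _ => by have := hβ i; positivity

theorem dPsi_nonneg (hβ : ∀ i, 0 ≤ β i) {p : ℝ} (hp : 0 ≤ p) : 0 ≤ dPsi V G β p :=
  Finset.sum_nonneg fun i _ => by have := hβ i; positivity

end Polynomial

section Reversibility

variable {s : ℕ} {V : Fin s → ℕ} {G : ∀ i, SimpleGraph (Fin (V i))} {β : Fin s → ℝ} {n : ℕ}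

theorem ergmRate_nonneg (e : EdgeSet n) (x : Config n) : 0 ≤ ergmRate V G β n e x :=
  (Phi_pos _).le

theorem ergmRate_le_one (e : EdgeSet n) (x : Config n) : ergmRate V G β n e x ≤ 1 :=
  (Phi_lt_one _).le

theorem ergmRate_monotone (hβ : ∀ i, 0 ≤ β i) (e : EdgeSet n) :
    Monotone (ergmRate V G β n e) := Phi_monotone.comp (dHam_monotone hβ e)

theorem flipWeight_ergmRate (x : Config n) (e : EdgeSet n) :
    flipWeight (ergmRate V G β n) x e = flipRate V G β x e := rfl

theorem dHam_update (e : EdgeSet n) (x : Config n) (b : Bool) :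
    dHam V G β e (Function.update x e b) = dHam V G β e x := by
  simp [dHam]

theorem isReversible_ergm : IsReversible (ergmRate V G β n) (ergmProb V G β) where
  nonneg x := div_nonneg (Real.exp_pos _).le (Finset.sum_nonneg fun _ _ => (Real.exp_pos _).le)
  sum_eq_one := by
    unfold ergmProb
    rw [← Finset.sum_div]
    exact div_self (Finset.sum_pos (fun _ _ => Real.exp_pos _) Finset.univ_nonempty).ne'
  rate_nonneg := ergmRate_nonneg
  rate_le_one := ergmRate_le_one
  balance x e := by
    have key : ∀ H₁ H₀ Z : ℝ, Real.exp H₁ / Z * (1 - Phi (H₁ - H₀)) =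
        Real.exp H₀ / Z * Phi (H₁ - H₀) := by
      intro H₁ H₀ Z
      have h1 : 1 - Phi (H₁ - H₀) = 1 / (1 + Real.exp (H₁ - H₀)) := by
        have := Real.exp_pos (H₁ - H₀)
        unfold Phi
        field_simp
        ring
      rw [h1, Phi, div_mul_div_comm, div_mul_div_comm, mul_one, ← Real.exp_add]
      congr 2
      ring
    simp only [flipWeight_ergmRate, flipRate, dHam_update, Function.update_self]
    rcases hx : x e
    · have h0 : Function.update x e false = x := by rw [← hx, Function.update_eq_self]
      have := key (Hamiltonian V G β (Function.update x e true)) (Hamiltonian V G β x)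
        (∑ y : Config n, Real.exp (Hamiltonian V G β y))
      simp only [Bool.false_eq_true, if_false, Bool.not_false, if_true, ergmProb, dHam, h0]
      exact this.symm
    · have h0 : Function.update x e true = x := by rw [← hx, Function.update_eq_self]
      have := key (Hamiltonian V G β x) (Hamiltonian V G β (Function.update x e false))
        (∑ y : Config n, Real.exp (Hamiltonian V G β y))
      simp only [Bool.false_eq_true, if_false, Bool.not_true, if_true, ergmProb, dHam, h0]
      exact this

end Reversibility

section BurnIn

theorem eventually_pow_mul_exp_neg_le (C : ℝ) (k : ℕ) {c : ℝ} (hc : 0 < c) :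
    ∀ᶠ n : ℕ in atTop, C * (n : ℝ) ^ k * Real.exp (-(c * n)) ≤ Real.exp (-(c / 2 * n)) := by
  have hr : |Real.exp (-(c / 2))| < 1 := by
    rw [abs_of_pos (Real.exp_pos _), Real.exp_lt_one_iff]; linarith
  have h := ((tendsto_pow_const_mul_const_pow_of_abs_lt_one k hr).const_mul C).eventually
    (gt_mem_nhds (show C * 0 < 1 by simp))
  filter_upwards [h] with n hn
  have h1 : Real.exp (-(c / 2)) ^ n = Real.exp (-(c / 2 * n)) := by
    rw [← Real.exp_nat_mul]; congr 1; ring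
  have h2 : Real.exp (-(c * n)) = Real.exp (-(c / 2 * n)) * Real.exp (-(c / 2 * n)) := by
    rw [← Real.exp_add]; congr 1; ring
  rw [h1] at hn
  calc C * (n : ℝ) ^ k * Real.exp (-(c * n))
      = C * ((n : ℝ) ^ k * Real.exp (-(c / 2 * n))) * Real.exp (-(c / 2 * n)) := by rw [h2]; ring
    _ ≤ 1 * Real.exp (-(c / 2 * n)) := mul_le_mul_of_nonneg_right hn.le (Real.exp_pos _).le
    _ = _ := one_mul _

theorem one_sub_card_inv_pow_le {E : Type*} [Fintype E] [Nonempty E] (K : ℕ) :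
    (1 - (Fintype.card E : ℝ)⁻¹) ^ (K * Fintype.card E) ≤ Real.exp (-K) := by
  have h1 : 1 - (Fintype.card E : ℝ)⁻¹ ≤ Real.exp (-(Fintype.card E : ℝ)⁻¹) := by
    linarith [Real.add_one_le_exp (-(Fintype.card E : ℝ)⁻¹)]
  refine (pow_le_pow_left₀ (sub_nonneg.mpr card_inv_le_one) h1 _).trans (le_of_eq ?_)
  rw [← Real.exp_nat_mul]
  congr 1
  have := card_inv_mul_card (E := E)
  push_cast
  linear_combination -(K : ℝ) * this

theorem card_edgeSet_le_sq (n : ℕ) : (Fintype.card (EdgeSet n) : ℝ) ≤ (n : ℝ) ^ 2 := by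
  have : Fintype.card (EdgeSet n) ≤ n ^ 2 := by
    have h := two_mul_card_edgeSet n
    have h2 : n * (n - 1) ≤ n ^ 2 := by rw [sq]; exact Nat.mul_le_mul_left _ (Nat.sub_le _ _)
    omega
  exact_mod_cast this

/-- Exponential tails, at a time of order `n ^ 2`, of polynomials with influences of order `1 / n`
under the chain with constant rates. -/
theorem exists_glauber_const_pow_poly_tail {m W b η : ℝ} (hm0 : 0 ≤ m) (hW0 : 0 ≤ W)
    (hb0 : 0 ≤ b) (hη : 0 < η) :
    ∃ (K : ℕ) (c : ℝ), 0 < c ∧ ∀ (n : ℕ) (_ : Nonempty (EdgeSet n)) (ι : Type) (_ : Fintype ι)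
      (w : ι → ℝ) (S : ι → Finset (EdgeSet n)) (q μ : ℝ), 0 ≤ q → q ≤ 1 → (∀ i, 0 ≤ w i) →
      (∀ i, (#(S i) : ℝ) ≤ m) → ∑ i, w i ≤ W →
      (∀ e, ∑ i, (if e ∈ S i then w i else 0) ≤ b / n) →
      (∑ i, w i * q ^ #(S i) ≤ μ → ∀ x, (glauber (fun _ _ => q) ^ (K * Fintype.card (EdgeSet n)))
        ({y | μ + η < poly w S y}.indicator 1) x ≤ Real.exp (-(c * n))) ∧
      (μ ≤ ∑ i, w i * q ^ #(S i) → ∀ x, (glauber (fun _ _ => q) ^ (K * Fintype.card (EdgeSet n)))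
        ({y | poly w S y < μ - η}.indicator 1) x ≤ Real.exp (-(c * n))) := by
  obtain ⟨K, hK⟩ : ∃ K : ℕ, m * W * Real.exp (-K) ≤ η / 2 := by
    have h : Tendsto (fun K : ℕ => m * W * Real.exp (-(K : ℝ))) atTop (nhds (m * W * 0)) :=
      (Real.tendsto_exp_neg_atTop_nhds_zero.comp tendsto_natCast_atTop_atTop).const_mul _
    obtain ⟨K, hK⟩ := (h.eventually (gt_mem_nhds (show m * W * 0 < η / 2 by simp [hη]))).exists
    exact ⟨K, hK.le⟩
  set l := min (1 / (b + 1)) (η / 4 / (m * W * b + 1)) with hl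
  have hmWb : 0 ≤ m * W * b := by positivity
  have hl0 : 0 < l := lt_min (by positivity) (by positivity)
  have hl1 : l * b ≤ 1 := by
    have h1 : l ≤ 1 / (b + 1) := min_le_left _ _
    rw [le_div_iff₀ (by positivity)] at h1
    nlinarith
  have hl2 : l * (m * W * b) ≤ η / 4 := by
    have h1 : l ≤ η / 4 / (m * W * b + 1) := min_le_right _ _
    rw [le_div_iff₀ (by positivity)] at h1
    nlinarith
  refine ⟨K, l * η / 4, by positivity, ?_⟩
  intro n _ ι _ w S q μ hq0 hq1 hw hm hW hB
  have hn : (0 : ℝ) < n := by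
    obtain ⟨⟨⟨u, v⟩, _⟩⟩ := ‹Nonempty (EdgeSet n)›
    exact Nat.cast_pos.mpr (Nat.lt_of_le_of_lt (Nat.zero_le _) u.2)
  have ht : m * W * (1 - (Fintype.card (EdgeSet n) : ℝ)⁻¹) ^ (K * Fintype.card (EdgeSet n)) ≤
      η / 2 :=
    (mul_le_mul_of_nonneg_left (one_sub_card_inv_pow_le K) (mul_nonneg hm0 hW0)).trans hK
  have hlB : l * n * (b / n) ≤ 1 := by
    rw [show l * n * (b / n) = l * b by field_simp]; exact hl1
  have hlv : l * n * (m * W * (b / n)) ≤ η / 4 := by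
    rw [show l * n * (m * W * (b / n)) = l * (m * W * b) by field_simp]; exact hl2
  have hexp : l * η / 4 * n = l * n * η / 4 := by ring
  rw [hexp]
  exact ⟨fun hμ x => glauber_const_pow_poly_upper hq0 hq1 _ hw hm hm0 hW (by positivity) hB
      (by positivity) hlB hlv ht hμ x,
    fun hμ x => glauber_const_pow_poly_lower hq0 hq1 _ hw hm hm0 hW (by positivity) hB
      (by positivity) hlB hlv ht hμ x⟩

variable {s : ℕ} {V : Fin s → ℕ} {G : ∀ i, SimpleGraph (Fin (V i))} {β : Fin s → ℝ}

variable (V G β) in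
/-- The sets `A n` have exponentially small probability for the Glauber dynamics started at `z n`,
after a burn-in time of order `n ^ 2`. -/
def Rare (z : ∀ n, Config n) (A : ∀ n, Set (Config n)) : Prop :=
  ∃ (K : ℕ) (c : ℝ), 0 < c ∧ ∀ᶠ n in atTop, ∀ t, K * Fintype.card (EdgeSet n) ≤ t →
    (glauber (ergmRate V G β n) ^ t) ((A n).indicator 1) (z n) ≤ Real.exp (-(c * n))

theorem Rare.mono {z : ∀ n, Config n} {A B : ∀ n, Set (Config n)} (hB : Rare V G β z B)
    (hAB : ∀ n, A n ⊆ B n) : Rare V G β z A := by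
  obtain ⟨K, c, hc, h⟩ := hB
  refine ⟨K, c, hc, ?_⟩
  filter_upwards [h] with n hn t ht
  refine le_trans (glauber_pow_le ergmRate_nonneg ergmRate_le_one t ?_ _) (hn t ht)
  exact Set.indicator_le_indicator_of_subset (hAB n) (fun _ => zero_le_one)

theorem rare_empty (z : ∀ n, Config n) : Rare V G β z (fun _ => ∅) :=
  ⟨0, 1, one_pos, Filter.Eventually.of_forall fun n t _ => by
    rw [show (∅ : Set (Config n)).indicator (1 : Config n → ℝ) = 0 from Set.indicator_empty' _,
      map_zero, Pi.zero_apply]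
    exact (Real.exp_pos _).le⟩

theorem eventually_nonempty_edgeSet : ∀ᶠ n : ℕ in atTop, Nonempty (EdgeSet n) := by
  filter_upwards [eventually_ge_atTop 2] with n hn
  rw [← Fintype.card_pos_iff, card_edgeSet]
  exact Nat.choose_pos hn

theorem Rare.of_comparison {z : ∀ n, Config n} {B : ∀ n, Set (Config n)} (hB : Rare V G β z B)
    {A : ∀ n, EdgeSet n → Set (Config n)} {q : ℝ} (hq0 : 0 ≤ q) (hq1 : q ≤ 1)
    (hA : ∃ (K : ℕ) (c : ℝ), 0 < c ∧ ∀ᶠ n in atTop, ∀ e x,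
      (glauber (fun _ _ => q) ^ (K * Fintype.card (EdgeSet n))) ((A n e).indicator 1) x ≤
        Real.exp (-(c * n)))
    (hcomp : ∀ n e t, ∀ x ∉ B n,
      glauber (ergmRate V G β n) ((glauber (fun _ _ => q) ^ t) ((A n e).indicator 1)) x ≤
        glauber (fun _ _ => q) ((glauber (fun _ _ => q) ^ t) ((A n e).indicator 1)) x) :
    Rare V G β z (fun n => {x | ∃ e, x ∈ A n e}) := by
  obtain ⟨K, c, hc, h⟩ := hB
  obtain ⟨K', c', hc', h'⟩ := hA
  set d := min c c' with hd
  have hd0 : 0 < d := lt_min hc hc'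
  refine ⟨K + K', d / 2, by positivity, ?_⟩
  filter_upwards [h, h', eventually_pow_mul_exp_neg_le (1 + K') 4 hd0,
    eventually_nonempty_edgeSet, eventually_ge_atTop 1] with n hn hn' hexp hne hn1 t ht
  set M := Fintype.card (EdgeSet n) with hM
  set P := glauber (ergmRate V G β n) with hP
  obtain ⟨T, rfl⟩ : ∃ T, t = T + K' * M := ⟨t - K' * M, by
    rw [Nat.sub_add_cancel (le_trans (Nat.mul_le_mul_right M (Nat.le_add_left K' K)) ht)]⟩
  have hT : K * M ≤ T := by rw [add_mul] at ht; omega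
  have hexpc : Real.exp (-(c * n)) ≤ Real.exp (-(d * n)) := Real.exp_le_exp.mpr
    (neg_le_neg (mul_le_mul_of_nonneg_right (min_le_left _ _) (Nat.cast_nonneg n)))
  have hexpc' : Real.exp (-(c' * n)) ≤ Real.exp (-(d * n)) := Real.exp_le_exp.mpr
    (neg_le_neg (mul_le_mul_of_nonneg_right (min_le_right _ _) (Nat.cast_nonneg n)))
  have hind0 : ∀ (D : Set (Config n)) x, (0 : ℝ) ≤ D.indicator 1 x := fun D x =>
    Set.indicator_nonneg (fun _ _ => zero_le_one) x
  have hind1 : ∀ (D : Set (Config n)) x, D.indicator (1 : Config n → ℝ) x ≤ 1 := fun D x =>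
    Set.indicator_le_self' (fun _ _ => zero_le_one) x
  have hsingle : ∀ e, (P ^ (T + K' * M)) ((A n e).indicator 1) (z n) ≤
      (1 + K' * M) * Real.exp (-(d * n)) := by
    intro e
    rw [glauber_pow_add_apply]
    have h1 := glauber_pow_le_add_sum (a := ergmRate V G β n) (b := fun _ _ => q)
      ergmRate_nonneg ergmRate_le_one (fun _ _ => hq0) (fun _ _ => hq1)
      (g := (A n e).indicator 1) (hind0 _) (hind1 _) (hcomp n e) (K' * M)
    have h2 := glauber_pow_le (a := ergmRate V G β n) ergmRate_nonneg ergmRate_le_one T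
      (g := (fun _ => Real.exp (-(c' * n))) + ∑ r ∈ Finset.range (K' * M),
        (P ^ r) ((B n).indicator 1)) (fun x => by
          refine (h1 x).trans ?_
          rw [Pi.add_apply, Finset.sum_apply]
          exact add_le_add (hn' e x) le_rfl) (z n)
    refine h2.trans ?_
    rw [map_add, map_sum, glauber_pow_const, Pi.add_apply, Finset.sum_apply, add_mul, one_mul]
    refine add_le_add hexpc' ?_
    calc _ ≤ ∑ r ∈ Finset.range (K' * M), Real.exp (-(d * n)) := by
          refine Finset.sum_le_sum fun r _ => ?_
          rw [← glauber_pow_add_apply]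
          exact (hn (T + r) (by omega)).trans hexpc
      _ = _ := by
          rw [Finset.sum_const, Finset.card_range, nsmul_eq_mul]; push_cast; ring
  have hunion : (P ^ (T + K' * M)) ({x | ∃ e, x ∈ A n e}.indicator 1) (z n) ≤
      ∑ e, (P ^ (T + K' * M)) ((A n e).indicator 1) (z n) := by
    rw [← Finset.sum_apply, ← map_sum]
    refine glauber_pow_le ergmRate_nonneg ergmRate_le_one _ (fun x => ?_) _
    rw [Finset.sum_apply]
    by_cases hx : ∃ e, x ∈ A n e
    · obtain ⟨e, he⟩ := hx
      rw [Set.indicator_of_mem (show x ∈ {x | ∃ e, x ∈ A n e} from ⟨e, he⟩)]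
      have := Finset.single_le_sum (f := fun e => (A n e).indicator (1 : Config n → ℝ) x)
        (fun e _ => hind0 _ _) (Finset.mem_univ e)
      rwa [Set.indicator_of_mem he] at this
    · rw [Set.indicator_of_notMem (show x ∉ {x | ∃ e, x ∈ A n e} from hx)]
      exact Finset.sum_nonneg fun e _ => hind0 _ _
  refine hunion.trans ((Finset.sum_le_sum fun e _ => hsingle e).trans ?_)
  rw [Finset.sum_const, Finset.card_univ, nsmul_eq_mul, ← hM]
  refine le_trans ?_ hexp
  have hMn := card_edgeSet_le_sq n
  rw [← hM] at hMn
  have hn1' : (1 : ℝ) ≤ n := Nat.one_le_cast.mpr hn1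
  have hM0 : (0 : ℝ) ≤ M := Nat.cast_nonneg M
  rw [← mul_assoc]
  refine mul_le_mul_of_nonneg_right ?_ (Real.exp_pos _).le
  have h1 : (1 : ℝ) ≤ (n : ℝ) ^ 2 := one_le_pow₀ hn1'
  calc (M : ℝ) * (1 + K' * M) ≤ (n : ℝ) ^ 2 * (n ^ 2 + K' * n ^ 2) := by gcongr
    _ = (1 + K') * (n : ℝ) ^ 4 := by ring

variable (V G β) in
/-- `∑ f, ∂_e ∂_f H`. -/
noncomputable def ddHam {n : ℕ} (e : EdgeSet n) : Config n → ℝ :=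
  poly (ddWeight (copyWeight V β n) (copySupport V G n) e) (ddSupport (copySupport V G n) e)

theorem sum_dHam_update_sub {n : ℕ} (x : Config n) (e : EdgeSet n) :
    ∑ f, (dHam V G β f (Function.update x e true) - dHam V G β f (Function.update x e false)) =
      ddHam V G β e x := by
  simp only [dHam_eq_poly]
  exact sum_poly_dWeight_update_sub x e

theorem ddHam_monotone (hβ : ∀ i, 0 ≤ β i) {n : ℕ} (e : EdgeSet n) : Monotone (ddHam V G β e) :=
  poly_monotone (ddWeight_nonneg (copyWeight_nonneg hβ) e) _

theorem monotone_indicator {α : Type*} [Preorder α] {A : Set α} (hA : IsUpperSet A) :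
    Monotone (A.indicator (1 : α → ℝ)) := by
  intro x y hxy
  by_cases hx : x ∈ A
  · rw [Set.indicator_of_mem hx, Set.indicator_of_mem (hA hxy hx)]; exact le_rfl
  · rw [Set.indicator_of_notMem hx]; exact Set.indicator_nonneg (fun _ _ => zero_le_one) _

theorem antitone_indicator {α : Type*} [Preorder α] {A : Set α} (hA : IsLowerSet A) :
    Antitone (A.indicator (1 : α → ℝ)) := by
  intro x y hxy
  by_cases hy : y ∈ A
  · rw [Set.indicator_of_mem hy, Set.indicator_of_mem (hA hxy hy)]; exact le_rfl
  · rw [Set.indicator_of_notMem hy]; exact Set.indicator_nonneg (fun _ _ => zero_le_one) _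

theorem sum_mul_cube_nonneg (hβ : ∀ i, 0 ≤ β i) : 0 ≤ ∑ i, β i * (V i : ℝ) ^ 3 :=
  Finset.sum_nonneg fun i _ => mul_nonneg (hβ i) (by positivity)

theorem Rare.dHam_gt (hβ : ∀ i, 0 ≤ β i) {z : ∀ n, Config n} {h η : ℝ}
    (hB : Rare V G β z fun n => {x | ∃ e : EdgeSet n, h < dHam V G β e x}) (hη : 0 < η) :
    Rare V G β z fun n => {x | ∃ e : EdgeSet n, Psi V G β (Phi h) + η < dHam V G β e x} := by
  refine hB.of_comparison (A := fun n e => {x | Psi V G β (Phi h) + η < dHam V G β e x})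
    (Phi_pos h).le (Phi_lt_one h).le ?_ ?_
  · obtain ⟨K, c, hc, H⟩ := exists_glauber_const_pow_poly_tail
      (m := ∑ i, (numEdges (G i) : ℝ)) (W := Psi V G β 1) (by positivity)
      (Psi_nonneg hβ zero_le_one) (sum_mul_cube_nonneg (V := V) hβ) hη
    refine ⟨K, c, hc, ?_⟩
    filter_upwards [eventually_nonempty_edgeSet] with n hn e x
    simp only [dHam_eq_poly]
    refine (H n hn _ _ _ _ (Phi h) _ (Phi_pos h).le (Phi_lt_one h).le
      (dWeight_nonneg (copyWeight_nonneg hβ) e) (fun ω => ?_) (sum_dWeight_le hβ e)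
      (fun f => ?_)).1 (sum_dWeight_mul_pow_le hβ e (Phi_pos h).le) x
    · exact (Nat.cast_le.mpr (Finset.card_erase_le)).trans (card_copySupport_le ω)
    · exact dWeight_influence_le (copyWeight_nonneg hβ)
        (div_nonneg (sum_mul_cube_nonneg hβ) (Nat.cast_nonneg n))
        (fun _ _ hef => sum_copyWeight_pair_le hβ hef) e f
  · intro n e t x hx
    refine glauber_le_of_rate_le (fun f => Phi_monotone ?_)
      (glauber_pow_monotone (fun _ _ => (Phi_pos h).le) (fun _ _ => (Phi_lt_one h).le)
        (fun _ => monotone_const) t (monotone_indicator fun y y' hy hy' => ?_))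
    · by_contra! hlt; exact hx ⟨f, hlt⟩
    · exact lt_of_lt_of_le hy' (dHam_monotone hβ e hy)

theorem Rare.ddHam_gt (hβ : ∀ i, 0 ≤ β i) {z : ∀ n, Config n} {h η : ℝ}
    (hB : Rare V G β z fun n => {x | ∃ e : EdgeSet n, h < dHam V G β e x}) (hη : 0 < η) :
    Rare V G β z fun n => {x | ∃ e : EdgeSet n, dPsi V G β (Phi h) + η < ddHam V G β e x} := by
  refine hB.of_comparison (A := fun n e => {x | dPsi V G β (Phi h) + η < ddHam V G β e x})
    (Phi_pos h).le (Phi_lt_one h).le ?_ ?_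
  · have hm0 : (0 : ℝ) ≤ ∑ i, (numEdges (G i) : ℝ) := by positivity
    obtain ⟨K, c, hc, H⟩ := exists_glauber_const_pow_poly_tail hm0
      (mul_nonneg hm0 (Psi_nonneg (V := V) (G := G) hβ zero_le_one))
      (mul_nonneg hm0 (sum_mul_cube_nonneg (V := V) hβ)) hη
    refine ⟨K, c, hc, ?_⟩
    filter_upwards [eventually_nonempty_edgeSet] with n hn e x
    refine (H n hn _ _ _ _ (Phi h) _ (Phi_pos h).le (Phi_lt_one h).le
      (ddWeight_nonneg (copyWeight_nonneg hβ) e) (fun ω => ?_)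
      (sum_ddWeight_le (copyWeight_nonneg hβ) card_copySupport_le hm0 (sum_dWeight_le hβ e))
      (fun f => ?_)).1 (sum_ddWeight_mul_pow_le hβ e (Phi_pos h).le) x
    · exact (Nat.cast_le.mpr (Finset.card_erase_le.trans Finset.card_erase_le)).trans
        (card_copySupport_le ω.1)
    · rw [mul_div_assoc]
      exact ddWeight_influence_le (copyWeight_nonneg hβ) card_copySupport_le hm0
        (div_nonneg (sum_mul_cube_nonneg hβ) (Nat.cast_nonneg n))
        (fun _ _ hef => sum_copyWeight_pair_le hβ hef) e f
  · intro n e t x hx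
    refine glauber_le_of_rate_le (fun f => Phi_monotone ?_)
      (glauber_pow_monotone (fun _ _ => (Phi_pos h).le) (fun _ _ => (Phi_lt_one h).le)
        (fun _ => monotone_const) t (monotone_indicator fun y y' hy hy' => ?_))
    · by_contra! hlt; exact hx ⟨f, hlt⟩
    · exact lt_of_lt_of_le hy' (ddHam_monotone hβ e hy)

theorem Rare.dHam_lt (hβ : ∀ i, 0 ≤ β i) {z : ∀ n, Config n} {h η : ℝ}
    (hB : Rare V G β z fun n => {x | ∃ e : EdgeSet n, dHam V G β e x < h}) (hη : 0 < η) :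
    Rare V G β z fun n => {x | ∃ e : EdgeSet n, dHam V G β e x < Psi V G β (Phi h) - η} := by
  refine hB.of_comparison (A := fun n e => {x | dHam V G β e x < Psi V G β (Phi h) - η})
    (Phi_pos h).le (Phi_lt_one h).le ?_ ?_
  · obtain ⟨K, c, hc, H⟩ := exists_glauber_const_pow_poly_tail
      (m := ∑ i, (numEdges (G i) : ℝ)) (W := Psi V G β 1) (by positivity)
      (Psi_nonneg hβ zero_le_one) (sum_mul_cube_nonneg (V := V) hβ) (half_pos hη)
    refine ⟨K, c, hc, ?_⟩
    filter_upwards [eventually_nonempty_edgeSet,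
      eventually_le_sum_dWeight_mul_pow (G := G) hβ (half_pos hη)] with n hn hmean e x
    have h1 : Psi V G β (Phi h) - η = Psi V G β (Phi h) - η / 2 - η / 2 := by ring
    simp only [dHam_eq_poly, h1]
    refine (H n hn _ _ _ _ (Phi h) _ (Phi_pos h).le (Phi_lt_one h).le
      (dWeight_nonneg (copyWeight_nonneg hβ) e) (fun ω => ?_) (sum_dWeight_le hβ e)
      (fun f => ?_)).2 (hmean e (Phi h) (Phi_pos h).le (Phi_lt_one h).le) x
    · exact (Nat.cast_le.mpr (Finset.card_erase_le)).trans (card_copySupport_le ω)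
    · exact dWeight_influence_le (copyWeight_nonneg hβ)
        (div_nonneg (sum_mul_cube_nonneg hβ) (Nat.cast_nonneg n))
        (fun _ _ hef => sum_copyWeight_pair_le hβ hef) e f
  · intro n e t x hx
    refine glauber_le_of_le_rate (fun f => Phi_monotone ?_)
      (glauber_pow_antitone (fun _ _ => (Phi_pos h).le) (fun _ _ => (Phi_lt_one h).le)
        (fun _ => monotone_const) t (antitone_indicator fun y y' hy hy' => ?_))
    · by_contra! hlt; exact hx ⟨f, hlt⟩
    · exact lt_of_le_of_lt (dHam_monotone hβ e hy) hy'

/-- A set of reals stable under the upper iteration of `F` contains everything above the last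
fixed point of `F`. -/
theorem mem_of_stable {F : ℝ → ℝ} (hF : Continuous F) {S : Set ℝ} {a : ℝ} (hne : S.Nonempty)
    (hup : ∀ h ∈ S, ∀ h', h ≤ h' → h' ∈ S) (hstep : ∀ h ∈ S, ∀ h', F h < h' → h' ∈ S)
    (hlt : ∀ h, a < h → F h < h) {h : ℝ} (hh : a < h) : h ∈ S := by
  by_contra hS
  have hlb : h ∈ lowerBounds S := fun x hx => by
    by_contra! hxh; exact hS (hup x hx h hxh.le)
  set i := sInf S with hi
  have hglb : IsGLB S i := isGLB_csInf hne ⟨h, hlb⟩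
  have hai : a < i := hh.trans_le (hglb.2 hlb)
  obtain ⟨r, hr1, hr2⟩ := exists_between (hlt i hai)
  obtain ⟨δ, hδ, hball⟩ := Metric.eventually_nhds_iff.mp (hF.continuousAt.eventually (gt_mem_nhds hr1))
  obtain ⟨x, hxS, hix, hx⟩ := hglb.exists_between (show i < i + δ by linarith)
  have h1 : F x < r := hball (by rw [Real.dist_eq, abs_of_nonneg (by linarith)]; linarith)
  exact absurd (hglb.1 (hstep x hxS r h1)) (not_le.mpr hr2)

section FixedPoint

variable {p : ℝ}

theorem Subcritical.eq_of_fixed (hsub : Subcritical V G β p) {h : ℝ}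
    (hh : Psi V G β (Phi h) = h) : h = Psi V G β p := by
  have h1 : Phi h = p := hsub.2.1 (Phi h) (by rw [phiFn, hh])
  rw [← h1, hh]

theorem Subcritical.Phi_Psi (hsub : Subcritical V G β p) : Phi (Psi V G β p) = p := hsub.1

theorem continuous_Psi_Phi : Continuous fun h => Psi V G β (Phi h) :=
  continuous_Psi.comp continuous_Phi

theorem continuous_Psi_Phi_sub : Continuous fun h => Psi V G β (Phi h) - h :=
  continuous_Psi_Phi.sub continuous_id

theorem Subcritical.lt_of_gt (hsub : Subcritical V G β p) (hβ : ∀ i, 0 ≤ β i) {h : ℝ}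
    (hh : Psi V G β p < h) : Psi V G β (Phi h) < h := by
  by_contra! hle
  obtain ⟨x, hx, hxe⟩ := intermediate_value_Icc' (le_max_left h (Psi V G β 1 + 1))
    (continuous_Psi_Phi_sub (V := V) (G := G) (β := β)).continuousOn
    (show (0 : ℝ) ∈ _ from ⟨by
      have h1 : Psi V G β (Phi (max h (Psi V G β 1 + 1))) ≤ Psi V G β 1 :=
        Psi_monotoneOn hβ (Phi_pos _).le (Set.mem_Ici.mpr zero_le_one) (Phi_lt_one _).le
      linarith [le_max_right h (Psi V G β 1 + 1)], by linarith⟩)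
  have := hsub.eq_of_fixed (sub_eq_zero.mp hxe)
  linarith [hx.1]

theorem Subcritical.gt_of_lt (hsub : Subcritical V G β p) (hβ : ∀ i, 0 ≤ β i) {h : ℝ}
    (hh : h < Psi V G β p) : h < Psi V G β (Phi h) := by
  by_contra! hle
  obtain ⟨x, hx, hxe⟩ := intermediate_value_Icc' (min_le_left h 0)
    (continuous_Psi_Phi_sub (V := V) (G := G) (β := β)).continuousOn
    (show (0 : ℝ) ∈ _ from ⟨by linarith, by
      linarith [Psi_nonneg (V := V) (G := G) hβ (Phi_pos (min h 0)).le, min_le_right h 0]⟩)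
  have := hsub.eq_of_fixed (sub_eq_zero.mp hxe)
  linarith [hx.2]

theorem Subcritical.rare_dHam_gt (hsub : Subcritical V G β p) (hβ : ∀ i, 0 ≤ β i)
    (z : ∀ n, Config n) {h : ℝ} (hh : Psi V G β p < h) :
    Rare V G β z fun n => {x | ∃ e : EdgeSet n, h < dHam V G β e x} := by
  refine mem_of_stable (S := {h | Rare V G β z fun n => {x | ∃ e : EdgeSet n, h < dHam V G β e x}})
    continuous_Psi_Phi ⟨Psi V G β 1, ?_⟩ ?_ ?_ (fun h hh => hsub.lt_of_gt hβ hh) hh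
  · refine (rare_empty z).mono fun n x hx => ?_
    obtain ⟨e, he⟩ := hx
    exact absurd (dHam_le hβ e x) (not_le.mpr he)
  · intro h hS h' hle
    exact hS.mono fun n x ⟨e, he⟩ => ⟨e, hle.trans_lt he⟩
  · intro h hS h' hlt
    have := Rare.dHam_gt hβ hS (sub_pos.mpr hlt)
    rwa [add_sub_cancel] at this

theorem Subcritical.rare_dHam_lt (hsub : Subcritical V G β p) (hβ : ∀ i, 0 ≤ β i)
    (z : ∀ n, Config n) {h : ℝ} (hh : h < Psi V G β p) :
    Rare V G β z fun n => {x | ∃ e : EdgeSet n, dHam V G β e x < h} := by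
  have key := mem_of_stable (F := fun h => -Psi V G β (Phi (-h)))
    (S := {h | Rare V G β z fun n => {x | ∃ e : EdgeSet n, dHam V G β e x < -h}})
    (continuous_Psi_Phi.comp continuous_neg).neg ⟨0, ?_⟩ ?_ ?_
    (a := -Psi V G β p) (fun h hh => ?_) (neg_lt_neg hh)
  · simpa using key
  · refine (rare_empty z).mono fun n x hx => ?_
    obtain ⟨e, he⟩ := hx
    rw [neg_zero] at he
    exact absurd (dHam_nonneg hβ e x) (not_le.mpr he)
  · intro h hS h' hle
    exact hS.mono fun n x ⟨e, he⟩ => ⟨e, he.trans_le (neg_le_neg hle)⟩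
  · intro h hS h' hlt
    have := Rare.dHam_lt hβ hS (η := h' - -Psi V G β (Phi (-h))) (sub_pos.mpr hlt)
    rwa [show Psi V G β (Phi (-h)) - (h' - -Psi V G β (Phi (-h))) = -h' by ring] at this
  · linarith [hsub.gt_of_lt hβ (neg_lt.mp hh)]

theorem Subcritical.rare_ddHam_gt (hsub : Subcritical V G β p) (hβ : ∀ i, 0 ≤ β i)
    (z : ∀ n, Config n) {ε : ℝ} (hε : 0 < ε) :
    Rare V G β z fun n => {x | ∃ e : EdgeSet n, dPsi V G β p + ε < ddHam V G β e x} := by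
  have hcont : ContinuousAt (fun h => dPsi V G β (Phi h)) (Psi V G β p) :=
    (continuous_dPsi.comp continuous_Phi).continuousAt
  have hlt : dPsi V G β (Phi (Psi V G β p)) < dPsi V G β p + ε / 2 := by
    rw [hsub.Phi_Psi]; linarith
  obtain ⟨δ, hδ, hball⟩ := Metric.eventually_nhds_iff.mp (hcont.eventually (gt_mem_nhds hlt))
  have h1 : dPsi V G β (Phi (Psi V G β p + δ / 2)) < dPsi V G β p + ε / 2 :=
    hball (by rw [Real.dist_eq, add_sub_cancel_left, abs_of_pos (half_pos hδ)]; linarith)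
  refine (Rare.ddHam_gt hβ (hsub.rare_dHam_gt hβ z (h := Psi V G β p + δ / 2) (by linarith))
    (half_pos hε)).mono fun n x ⟨e, he⟩ => ⟨e, ?_⟩
  linarith

end FixedPoint

end BurnIn

section Contraction

variable {E : Type*} [Fintype E] [DecidableEq E]

theorem sum_mono_singleton_update (x : E → Bool) (e : E) (b : Bool) :
    (∑ f : E, mono {f}) (Function.update x e b) =
      (∑ f : E, mono {f}) x - mono {e} x + if b = true then 1 else 0 := by
  have h : ∀ f : E, mono {f} (Function.update x e b) =
      mono {f} x + if f = e then (if b = true then 1 else 0) - mono {e} x else 0 := by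
    intro f
    by_cases hf : f = e
    · subst hf; simp [mono]
    · simp [mono, hf]
  simp only [Finset.sum_apply, h, Finset.sum_add_distrib, Finset.sum_ite_eq', Finset.mem_univ,
    if_true]
  ring

theorem sum_mono_singleton_update_sub (x : E → Bool) (e : E) :
    (∑ f : E, mono {f}) (Function.update x e true) -
      (∑ f : E, mono {f}) (Function.update x e false) = 1 := by
  rw [sum_mono_singleton_update, sum_mono_singleton_update]; simp

omit [DecidableEq E] in
theorem sum_mono_singleton_nonneg (x : E → Bool) : 0 ≤ (∑ f : E, mono {f}) x := by
  rw [Finset.sum_apply]; exact Finset.sum_nonneg fun f _ => mono_nonneg _ _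

omit [DecidableEq E] in
theorem sum_mono_singleton_le (x : E → Bool) : (∑ f : E, mono {f}) x ≤ Fintype.card E := by
  rw [Finset.sum_apply]
  refine (Finset.sum_le_card_nsmul _ _ 1 fun f _ => mono_le_one _ _).trans (le_of_eq ?_)
  rw [Finset.card_univ, nsmul_one]

theorem glauber_sum_mono_singleton [Nonempty E] (a : E → (E → Bool) → ℝ) (κ : ℝ) :
    glauber a (∑ f : E, mono {f}) = (1 - κ * (Fintype.card E : ℝ)⁻¹) • (∑ f : E, mono {f}) -
      (Fintype.card E : ℝ)⁻¹ • ((1 - κ) • (∑ f : E, mono {f}) - ∑ f, a f) := by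
  funext x
  have h : ∀ e, a e x * (∑ f : E, mono {f}) (Function.update x e true) +
      (1 - a e x) * (∑ f : E, mono {f}) (Function.update x e false) =
      (∑ f : E, mono {f}) x - mono {e} x + a e x := by
    intro e
    simp only [sum_mono_singleton_update, if_true, Bool.false_eq_true, if_false]
    ring
  simp only [glauber_apply, h, Finset.sum_add_distrib, Finset.sum_sub_distrib, Finset.sum_const,
    Finset.card_univ, nsmul_eq_mul, Pi.sub_apply, Pi.smul_apply, smul_eq_mul,
    ← Finset.sum_apply (g := fun f : E => mono {f})]
  rw [Finset.sum_apply (g := a)]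
  linear_combination (∑ f : E, mono {f}) x * card_inv_mul_card (E := E)

variable {a : E → (E → Bool) → ℝ}

/-- If, outside an up-set `A` and a down-set `B`, flipping an edge changes the total rate by at
most `1 - κ`, then `(1 - κ) ∑ x_f - ∑ a_f` is increasing up to corrections supported on `A ∪ B`. -/
theorem monotone_corrected (h0 : ∀ e x, 0 ≤ a e x) (h1 : ∀ e x, a e x ≤ 1)
    {κ : ℝ} (hκ : κ ≤ 1) {A B : Set (E → Bool)} (hA : IsUpperSet A) (hB : IsLowerSet B)
    (hgood : ∀ x e, Function.update x e true ∉ A → Function.update x e false ∉ B →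
      ∑ f, (a f (Function.update x e true) - a f (Function.update x e false)) ≤ 1 - κ) :
    Monotone fun x => (1 - κ) * (∑ f : E, mono {f}) x - ∑ f, a f x +
      Fintype.card E * ((∑ f : E, mono {f}) x * A.indicator 1 x) -
      Fintype.card E * ((Fintype.card E - (∑ f : E, mono {f}) x) * B.indicator 1 x) := by
  refine monotone_of_update fun x e => ?_
  have hle := update_false_le_update_true x e
  have hS := sum_mono_singleton_update_sub x e
  have hS0 := sum_mono_singleton_nonneg (Function.update x e false)
  have hS1 := sum_mono_singleton_le (Function.update x e true)
  set y := Function.update x e true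
  set z := Function.update x e false
  set M : ℝ := (Fintype.card E : ℝ)
  have hM0 : (0 : ℝ) ≤ M := Nat.cast_nonneg _
  have hdiff : ∑ f, a f y - ∑ f, a f z ≤ M := by
    rw [← Finset.sum_sub_distrib]
    refine (Finset.sum_le_card_nsmul _ _ 1 fun f _ => ?_).trans (le_of_eq ?_)
    · linarith [h0 f z, h1 f y]
    · rw [Finset.card_univ, nsmul_one]
  have hgain : ∀ {u v : ℝ}, u + 1 ≤ v → M * u + M ≤ M * v := fun huv => by nlinarith
  have hgain' : ∀ {u v : ℝ}, u ≤ v → M * u ≤ M * v := fun huv =>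
    mul_le_mul_of_nonneg_left huv hM0
  have hAle : (∑ f : E, mono {f}) z * A.indicator 1 z ≤ (∑ f : E, mono {f}) y * A.indicator 1 y :=
    mul_le_mul (by linarith) (monotone_indicator hA hle)
      (Set.indicator_nonneg (fun _ _ => zero_le_one) _) (by linarith)
  have hBle : (M - (∑ f : E, mono {f}) y) * B.indicator 1 y ≤
      (M - (∑ f : E, mono {f}) z) * B.indicator 1 z :=
    mul_le_mul (by linarith) (antitone_indicator hB hle)
      (Set.indicator_nonneg (fun _ _ => zero_le_one) _) (by linarith)
  by_cases hyA : y ∈ A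
  · have : (∑ f : E, mono {f}) z * A.indicator 1 z + 1 ≤
        (∑ f : E, mono {f}) y * A.indicator 1 y := by
      rw [Set.indicator_of_mem hyA]
      by_cases hzA : z ∈ A
      · rw [Set.indicator_of_mem hzA]; simp only [Pi.one_apply]; linarith
      · rw [Set.indicator_of_notMem hzA]; simp only [Pi.one_apply]; linarith
    linarith [hgain this, hgain' hBle, congrArg (fun u => (1 - κ) * u) hS]
  · by_cases hzB : z ∈ B
    · have : (M - (∑ f : E, mono {f}) y) * B.indicator 1 y + 1 ≤
          (M - (∑ f : E, mono {f}) z) * B.indicator 1 z := by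
        rw [Set.indicator_of_mem hzB]
        by_cases hyB : y ∈ B
        · rw [Set.indicator_of_mem hyB]; simp only [Pi.one_apply]; linarith
        · rw [Set.indicator_of_notMem hyB]; simp only [Pi.one_apply]; linarith
      linarith [hgain this, hgain' hAle, congrArg (fun u => (1 - κ) * u) hS]
    · have h2 := hgood x e hyA hzB
      rw [Finset.sum_sub_distrib] at h2
      linarith [hgain' hBle, hgain' hAle, congrArg (fun u => (1 - κ) * u) hS]

theorem glauber_pow_corrected_le [Nonempty E] (h0 : ∀ e x, 0 ≤ a e x) (h1 : ∀ e x, a e x ≤ 1)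
    (ha : ∀ e, Monotone (a e)) {κ : ℝ} (hκ : κ ≤ 1) {A B : Set (E → Bool)}
    (hA : IsUpperSet A) (hB : IsLowerSet B)
    (hgood : ∀ x e, Function.update x e true ∉ A → Function.update x e false ∉ B →
      ∑ f, (a f (Function.update x e true) - a f (Function.update x e false)) ≤ 1 - κ) (t : ℕ) :
    (glauber a ^ t) ((1 - κ) • (∑ f : E, mono {f}) - ∑ f, a f) ⊥ ≤
      (glauber a ^ t) ((1 - κ) • (∑ f : E, mono {f}) - ∑ f, a f) ⊤ +
        (Fintype.card E : ℝ) ^ 2 *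
          ((glauber a ^ t) (A.indicator 1) ⊤ + (glauber a ^ t) (B.indicator 1) ⊥) := by
  set M : ℝ := (Fintype.card E : ℝ)
  have hM0 : (0 : ℝ) ≤ M := Nat.cast_nonneg _
  obtain ⟨Q, hQ⟩ : ∃ Q : (E → Bool) → ℝ, Q = fun x => (1 - κ) * (∑ f : E, mono {f}) x -
      ∑ f, a f x + M * ((∑ f : E, mono {f}) x * A.indicator 1 x) -
      M * ((M - (∑ f : E, mono {f}) x) * B.indicator 1 x) := ⟨_, rfl⟩
  have hmon := glauber_pow_monotone h0 h1 ha t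
    (hQ ▸ monotone_corrected h0 h1 hκ hA hB hgood : Monotone Q) (bot_le : (⊥ : E → Bool) ≤ ⊤)
  set W : (E → Bool) → ℝ := (1 - κ) • (∑ f : E, mono {f}) - ∑ f, a f with hW
  have hWx : ∀ x, W x = (1 - κ) * (∑ f : E, mono {f}) x - ∑ f, a f x := fun x => by
    rw [hW, Pi.sub_apply, Pi.smul_apply, smul_eq_mul, Finset.sum_apply (g := a)]
  have hind : ∀ (D : Set (E → Bool)) x, (0 : ℝ) ≤ D.indicator 1 x := fun D x =>
    Set.indicator_nonneg (fun _ _ => zero_le_one) x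
  have hS0 := sum_mono_singleton_nonneg (E := E)
  have hS1 := sum_mono_singleton_le (E := E)
  have hlow := glauber_pow_le h0 h1 t (f := W - M ^ 2 • B.indicator 1) (g := Q)
    (fun x => by
      rw [Pi.sub_apply, Pi.smul_apply, smul_eq_mul, hWx, hQ]
      have h2 := mul_nonneg hM0 (mul_nonneg (hS0 x) (hind A x))
      have h3 := mul_nonneg hM0 (mul_nonneg (hS0 x) (hind B x))
      linarith) ⊥
  have hupp := glauber_pow_le h0 h1 t (f := Q) (g := W + M ^ 2 • A.indicator 1)
    (fun x => by
      rw [Pi.add_apply, Pi.smul_apply, smul_eq_mul, hWx, hQ]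
      have h2 := mul_nonneg hM0 (mul_nonneg (sub_nonneg.mpr (hS1 x)) (hind A x))
      have h3 := mul_nonneg hM0 (mul_nonneg (sub_nonneg.mpr (hS1 x)) (hind B x))
      linarith) ⊤
  rw [map_sub, map_smul, Pi.sub_apply, Pi.smul_apply, smul_eq_mul] at hlow
  rw [map_add, map_smul, Pi.add_apply, Pi.smul_apply, smul_eq_mul] at hupp
  linarith

theorem glauber_pow_sum_mono_sub_le [Nonempty E] (h0 : ∀ e x, 0 ≤ a e x)
    (h1 : ∀ e x, a e x ≤ 1) (ha : ∀ e, Monotone (a e)) {κ : ℝ} (hκ0 : 0 ≤ κ) (hκ : κ ≤ 1)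
    {A B : Set (E → Bool)} (hA : IsUpperSet A) (hB : IsLowerSet B)
    (hgood : ∀ x e, Function.update x e true ∉ A → Function.update x e false ∉ B →
      ∑ f, (a f (Function.update x e true) - a f (Function.update x e false)) ≤ 1 - κ)
    {ε : ℝ} (hε : 0 ≤ ε) {t₀ : ℕ}
    (hAε : ∀ t, t₀ ≤ t → (glauber a ^ t) (A.indicator 1) ⊤ ≤ ε)
    (hBε : ∀ t, t₀ ≤ t → (glauber a ^ t) (B.indicator 1) ⊥ ≤ ε) (k : ℕ) :
    (glauber a ^ (t₀ + k)) (∑ f : E, mono {f}) ⊤ - (glauber a ^ (t₀ + k)) (∑ f : E, mono {f}) ⊥ ≤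
      (1 - κ * (Fintype.card E : ℝ)⁻¹) ^ k * Fintype.card E +
        k * (2 * Fintype.card E * ε) := by
  set M : ℝ := (Fintype.card E : ℝ)
  have hM0 : (0 : ℝ) ≤ M := Nat.cast_nonneg _
  have hr0 : 0 ≤ 1 - κ * M⁻¹ := by
    have h2 : M⁻¹ ≤ 1 := card_inv_le_one (E := E)
    have h3 : 0 ≤ M⁻¹ := inv_nonneg.mpr hM0
    nlinarith
  have hr1 : 1 - κ * M⁻¹ ≤ 1 := sub_le_self _ (mul_nonneg hκ0 (inv_nonneg.mpr hM0))
  induction k with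
  | zero =>
    have h2 := glauber_pow_le_const h0 h1 t₀ (sum_mono_singleton_le (E := E)) ⊤
    have h3 := const_le_glauber_pow h0 h1 t₀ (sum_mono_singleton_nonneg (E := E)) ⊥
    simp only [add_zero, pow_zero, one_mul, Nat.cast_zero, zero_mul]
    linarith
  | succ k ih =>
    have hstep := glauber_pow_corrected_le h0 h1 ha hκ hA hB hgood (t₀ + k)
    have h2 := hAε (t₀ + k) (Nat.le_add_right _ _)
    have h3 := hBε (t₀ + k) (Nat.le_add_right _ _)
    rw [← add_assoc, glauber_pow_succ_apply, glauber_sum_mono_singleton a κ, map_sub, map_smul,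
      map_smul]
    simp only [Pi.sub_apply, Pi.smul_apply, smul_eq_mul]
    set u := (glauber a ^ (t₀ + k)) ((1 - κ) • (∑ f : E, mono {f}) - ∑ f, a f) ⊥
    set v := (glauber a ^ (t₀ + k)) ((1 - κ) • (∑ f : E, mono {f}) - ∑ f, a f) ⊤
    have h4 : M⁻¹ * (u - v) ≤ 2 * M * ε := by
      have h5 : u - v ≤ M ^ 2 * (ε + ε) := by
        have := mul_le_mul_of_nonneg_left (add_le_add h2 h3) (sq_nonneg M)
        linarith
      calc M⁻¹ * (u - v) ≤ M⁻¹ * (M ^ 2 * (ε + ε)) :=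
            mul_le_mul_of_nonneg_left h5 (inv_nonneg.mpr hM0)
        _ = (M⁻¹ * M) * (2 * M * ε) := by ring
        _ = _ := by rw [card_inv_mul_card, one_mul]
    have h6 := mul_le_mul_of_nonneg_left ih hr0
    have h7 : (1 - κ * M⁻¹) * (k * (2 * M * ε)) ≤ k * (2 * M * ε) :=
      mul_le_of_le_one_left (by positivity) hr1
    rw [pow_succ]
    push_cast
    linarith

end Contraction

section Gap

variable {s : ℕ} {V : Fin s → ℕ} {G : ∀ i, SimpleGraph (Fin (V i))} {β : Fin s → ℝ} {p : ℝ}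

theorem Rare.union {z : ∀ n, Config n} {A B : ∀ n, Set (Config n)} (hA : Rare V G β z A)
    (hB : Rare V G β z B) : Rare V G β z fun n => A n ∪ B n := by
  obtain ⟨K, c, hc, h⟩ := hA
  obtain ⟨K', c', hc', h'⟩ := hB
  have hd : 0 < min c c' := lt_min hc hc'
  refine ⟨max K K', min c c' / 2, half_pos hd, ?_⟩
  filter_upwards [h, h', eventually_pow_mul_exp_neg_le 2 0 hd] with n hn hn' hexp t ht
  have h1 := hn t ((Nat.mul_le_mul_right _ (le_max_left _ _)).trans ht)
  have h2 := hn' t ((Nat.mul_le_mul_right _ (le_max_right _ _)).trans ht)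
  have h3 : Real.exp (-(c * n)) ≤ Real.exp (-(min c c' * n)) := Real.exp_le_exp.mpr
    (neg_le_neg (mul_le_mul_of_nonneg_right (min_le_left _ _) (Nat.cast_nonneg n)))
  have h4 : Real.exp (-(c' * n)) ≤ Real.exp (-(min c c' * n)) := Real.exp_le_exp.mpr
    (neg_le_neg (mul_le_mul_of_nonneg_right (min_le_right _ _) (Nat.cast_nonneg n)))
  have h5 := glauber_pow_le (a := ergmRate V G β n) ergmRate_nonneg ergmRate_le_one t
    (f := (A n ∪ B n).indicator 1) (g := (A n).indicator 1 + (B n).indicator 1)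
    (fun x => by
      have hA0 : (0 : ℝ) ≤ (A n).indicator 1 x := Set.indicator_nonneg (fun _ _ => zero_le_one) x
      have hB0 : (0 : ℝ) ≤ (B n).indicator 1 x := Set.indicator_nonneg (fun _ _ => zero_le_one) x
      rw [Pi.add_apply]
      by_cases hxA : x ∈ A n
      · rw [Set.indicator_of_mem (Set.mem_union_left _ hxA), Set.indicator_of_mem hxA]
        linarith
      · by_cases hxB : x ∈ B n
        · rw [Set.indicator_of_mem (Set.mem_union_right _ hxB), Set.indicator_of_mem hxB]
          linarith
        · rw [Set.indicator_of_notMem (fun hx => hx.elim hxA hxB)]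
          linarith) (z n)
  rw [map_add, Pi.add_apply] at h5
  rw [pow_zero, mul_one] at hexp
  linarith

theorem Subcritical.Phi_mul_dPsi_lt_one (hsub : Subcritical V G β p) :
    Phi (Psi V G β p) * (1 - Phi (Psi V G β p)) * dPsi V G β p < 1 := by
  have h : HasDerivAt (phiFn V G β) _ p := (hasDerivAt_Phi (Psi V G β p)).comp p (hasDerivAt_Psi p)
  rw [← h.deriv]
  exact hsub.2.2

theorem Subcritical.exists_contraction (hsub : Subcritical V G β p) (hβ : ∀ i, 0 ≤ β i) :
    ∃ δ ε κ : ℝ, 0 < δ ∧ 0 < ε ∧ 0 < κ ∧ κ ≤ 1 ∧ ∀ h, |h - Psi V G β p| ≤ δ →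
      Phi h * (1 - Phi h) * (dPsi V G β p + ε) ≤ 1 - κ := by
  have hp0 : 0 < p := by rw [← hsub.Phi_Psi]; exact Phi_pos _
  have hd := dPsi_nonneg (V := V) (G := G) hβ hp0.le
  have hlt := hsub.Phi_mul_dPsi_lt_one
  have hu0 := Phi_pos (Psi V G β p)
  have hu1 := Phi_lt_one (Psi V G β p)
  set u := Phi (Psi V G β p)
  have hc0 : 0 < u * (1 - u) := mul_pos hu0 (sub_pos.mpr hu1)
  have hc1 : u * (1 - u) ≤ 1 := by nlinarith
  obtain ⟨ε, hεdef⟩ : ∃ ε, ε = (1 - u * (1 - u) * dPsi V G β p) / 2 := ⟨_, rfl⟩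
  have hε : 0 < ε := by rw [hεdef]; linarith
  obtain ⟨L, hLdef⟩ : ∃ L, L = u * (1 - u) * (dPsi V G β p + ε) := ⟨_, rfl⟩
  have hL0 : 0 ≤ L := by rw [hLdef]; positivity
  have hL1 : L < 1 := by
    have := mul_le_mul_of_nonneg_right hc1 hε.le
    rw [hLdef]; linarith
  have hcont : ContinuousAt (fun h => Phi h * (1 - Phi h) * (dPsi V G β p + ε))
      (Psi V G β p) :=
    ((continuous_Phi.mul (continuous_const.sub continuous_Phi)).mul
      continuous_const).continuousAt
  obtain ⟨δ, hδ, hball⟩ := Metric.eventually_nhds_iff.mp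
    (hcont.eventually (gt_mem_nhds (show _ < 1 - (1 - L) / 2 by
      change u * (1 - u) * (dPsi V G β p + ε) < _
      rw [← hLdef]; linarith)))
  refine ⟨δ / 2, ε, (1 - L) / 2, half_pos hδ, hε, by linarith, by linarith, fun h hh => ?_⟩
  exact (hball (by rw [Real.dist_eq]; linarith)).le

theorem Phi_sub_le {h₀ δ C : ℝ} (hC : ∀ h, |h - h₀| ≤ δ → Phi h * (1 - Phi h) ≤ C) {u v : ℝ}
    (huv : u ≤ v) (hu : h₀ - δ ≤ u) (hv : v ≤ h₀ + δ) : Phi v - Phi u ≤ C * (v - u) := by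
  refine (convex_Icc u v).image_sub_le_mul_sub_of_deriv_le continuous_Phi.continuousOn
    (fun x _ => (hasDerivAt_Phi x).differentiableAt.differentiableWithinAt) (fun x hx => ?_)
    u (Set.left_mem_Icc.mpr huv) v (Set.right_mem_Icc.mpr huv) huv
  have hx' := interior_subset hx
  rw [(hasDerivAt_Phi x).deriv]
  exact hC x (abs_le.mpr ⟨by linarith [hx'.1], by linarith [hx'.2]⟩)

theorem sum_ergmRate_update_sub_le (hβ : ∀ i, 0 ≤ β i) {h₀ δ D κ : ℝ} (hD : 0 < D)
    (hcon : ∀ h, |h - h₀| ≤ δ → Phi h * (1 - Phi h) * D ≤ 1 - κ) (hκ : κ ≤ 1)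
    {n : ℕ} (x : Config n) (e : EdgeSet n)
    (hup : ∀ f, dHam V G β f (Function.update x e true) ≤ h₀ + δ)
    (hdd : ddHam V G β e (Function.update x e true) ≤ D)
    (hlow : ∀ f, h₀ - δ ≤ dHam V G β f (Function.update x e false)) :
    ∑ f, (ergmRate V G β n f (Function.update x e true) -
      ergmRate V G β n f (Function.update x e false)) ≤ 1 - κ := by
  have hC0 : 0 ≤ (1 - κ) / D := div_nonneg (sub_nonneg.mpr hκ) hD.le
  have hle : x ≤ Function.update x e true := by
    rw [le_update_iff]; exact ⟨le_top, fun _ _ => le_rfl⟩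
  calc _ ≤ ∑ f, (1 - κ) / D * (dHam V G β f (Function.update x e true) -
        dHam V G β f (Function.update x e false)) := Finset.sum_le_sum fun f _ =>
        Phi_sub_le (fun h hh => (le_div_iff₀ hD).mpr (hcon h hh))
          (dHam_monotone hβ f (update_false_le_update_true x e)) (hlow f) (hup f)
    _ = (1 - κ) / D * ddHam V G β e x := by rw [← Finset.mul_sum, sum_dHam_update_sub]
    _ ≤ (1 - κ) / D * D :=
        mul_le_mul_of_nonneg_left ((ddHam_monotone hβ e hle).trans hdd) hC0
    _ = 1 - κ := div_mul_cancel₀ _ hD.ne'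

/-- After `O(n)` sweeps, the expected Hamming distance between the monotonically coupled chains
started at the complete and at the empty graph is exponentially small. -/
theorem Subcritical.exists_hamming_le (hsub : Subcritical V G β p) (hβ : ∀ i, 0 ≤ β i) :
    ∃ (K : ℕ) (c : ℝ), 0 < c ∧ ∀ᶠ n in atTop,
      (glauber (ergmRate V G β n) ^ ((K + n) * Fintype.card (EdgeSet n))) (∑ f, mono {f}) ⊤ -
        (glauber (ergmRate V G β n) ^ ((K + n) * Fintype.card (EdgeSet n))) (∑ f, mono {f}) ⊥ ≤
      Real.exp (-(c * n)) := by
  obtain ⟨δ, ε, κ, hδ, hε, hκ0, hκ1, hcon⟩ := hsub.exists_contraction hβ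
  have hp0 : 0 < p := by rw [← hsub.Phi_Psi]; exact Phi_pos _
  have hD : 0 < dPsi V G β p + ε :=
    add_pos_of_nonneg_of_pos (dPsi_nonneg (V := V) (G := G) hβ hp0.le) hε
  obtain ⟨K, c, hc, hA⟩ := (hsub.rare_dHam_gt hβ (fun _ => ⊤) (lt_add_of_pos_right _ hδ)).union
    (hsub.rare_ddHam_gt hβ (fun _ => ⊤) hε)
  obtain ⟨K', c', hc', hB⟩ := hsub.rare_dHam_lt hβ (fun _ => ⊥) (sub_lt_self _ hδ)
  obtain ⟨d, hd⟩ : ∃ d, d = min κ (min c c') := ⟨_, rfl⟩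
  have hd0 : 0 < d := by rw [hd]; exact lt_min hκ0 (lt_min hc hc')
  refine ⟨max K K', d / 2, half_pos hd0, ?_⟩
  filter_upwards [hA, hB, eventually_nonempty_edgeSet, eventually_ge_atTop 1,
    eventually_pow_mul_exp_neg_le 3 5 hd0] with n hAn hBn hne hn1 hexp
  have hdc : d ≤ c := hd ▸ (min_le_right _ _).trans (min_le_left _ _)
  have hdc' : d ≤ c' := hd ▸ (min_le_right _ _).trans (min_le_right _ _)
  have hdκ : d ≤ κ := hd ▸ min_le_left _ _
  have hexp_le : ∀ {r : ℝ}, d ≤ r → Real.exp (-(r * n)) ≤ Real.exp (-(d * n)) := fun hr =>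
    Real.exp_le_exp.mpr (neg_le_neg (mul_le_mul_of_nonneg_right hr (Nat.cast_nonneg n)))
  have key := glauber_pow_sum_mono_sub_le (a := ergmRate V G β n) ergmRate_nonneg ergmRate_le_one
    (ergmRate_monotone hβ) hκ0.le hκ1
    (A := {x | ∃ e : EdgeSet n, Psi V G β p + δ < dHam V G β e x} ∪
      {x | ∃ e : EdgeSet n, dPsi V G β p + ε < ddHam V G β e x})
    (B := {x | ∃ e : EdgeSet n, dHam V G β e x < Psi V G β p - δ})
    (fun x y hxy hx => hx.imp
      (fun ⟨e, he⟩ => ⟨e, he.trans_le (dHam_monotone hβ e hxy)⟩)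
      (fun ⟨e, he⟩ => ⟨e, he.trans_le (ddHam_monotone hβ e hxy)⟩))
    (fun x y hxy ⟨e, he⟩ => ⟨e, (dHam_monotone hβ e hxy).trans_lt he⟩)
    (fun x e hxA hxB => sum_ergmRate_update_sub_le hβ hD hcon hκ1 x e
      (fun f => not_lt.mp fun hf => hxA (Or.inl ⟨f, hf⟩))
      (not_lt.mp fun hf => hxA (Or.inr ⟨e, hf⟩))
      (fun f => not_lt.mp fun hf => hxB ⟨f, hf⟩))
    (Real.exp_pos (-(d * n))).le (t₀ := max K K' * Fintype.card (EdgeSet n))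
    (fun t ht => (hAn t ((Nat.mul_le_mul_right _ (le_max_left _ _)).trans ht)).trans
      (hexp_le hdc))
    (fun t ht => (hBn t ((Nat.mul_le_mul_right _ (le_max_right _ _)).trans ht)).trans
      (hexp_le hdc')) (n * Fintype.card (EdgeSet n))
  rw [← add_mul] at key
  refine key.trans (le_trans ?_ hexp)
  have hpow : (1 - κ * (Fintype.card (EdgeSet n) : ℝ)⁻¹) ^ (n * Fintype.card (EdgeSet n)) ≤
      Real.exp (-(d * n)) := by
    refine le_trans ?_ (hexp_le hdκ)
    have h0 : 0 ≤ 1 - κ * (Fintype.card (EdgeSet n) : ℝ)⁻¹ := by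
      nlinarith [card_inv_le_one (E := EdgeSet n),
        inv_nonneg.mpr (Nat.cast_nonneg (α := ℝ) (Fintype.card (EdgeSet n)))]
    have h1 : 1 - κ * (Fintype.card (EdgeSet n) : ℝ)⁻¹ ≤
        Real.exp (-(κ * (Fintype.card (EdgeSet n) : ℝ)⁻¹)) := by
      linarith [Real.add_one_le_exp (-(κ * (Fintype.card (EdgeSet n) : ℝ)⁻¹))]
    refine (pow_le_pow_left₀ h0 h1 _).trans (le_of_eq ?_)
    rw [← Real.exp_nat_mul]
    congr 1
    push_cast
    linear_combination -(κ * n) * card_inv_mul_card (E := EdgeSet n)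
  have hM := card_edgeSet_le_sq n
  have hM0 : (0 : ℝ) ≤ Fintype.card (EdgeSet n) := Nat.cast_nonneg _
  set M : ℝ := (Fintype.card (EdgeSet n) : ℝ)
  have hn1' : (1 : ℝ) ≤ n := Nat.one_le_cast.mpr hn1
  have he0 := (Real.exp_pos (-(d * n))).le
  push_cast
  calc _ ≤ Real.exp (-(d * n)) * (n : ℝ) ^ 5 +
        n * n ^ 2 * (2 * n ^ 2 * Real.exp (-(d * n))) := by
        have h25 : M ≤ (n : ℝ) ^ 5 := hM.trans (pow_le_pow_right₀ hn1' (by norm_num))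
        gcongr
    _ = _ := by ring

theorem Subcritical.exists_poincare (hsub : Subcritical V G β p) (hβ : ∀ i, 0 ≤ β i) :
    ∃ c : ℝ, 0 < c ∧ ∀ᶠ n : ℕ in atTop, ∀ f : Config n → ℝ, expect (ergmProb V G β) f = 0 →
      c / (n : ℝ) ^ 2 * expect (ergmProb V G β) (fun x => f x ^ 2) ≤ dirichlet V G β f := by
  obtain ⟨K, c, hc, H⟩ := hsub.exists_hamming_le hβ
  refine ⟨2 * (c / (2 + c)), by positivity, ?_⟩
  filter_upwards [H, eventually_nonempty_edgeSet, eventually_ge_atTop 1,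
    eventually_ge_atTop K] with n hn hne hn1 hnK f hf
  have hMcard : 0 < Fintype.card (EdgeSet n) := Fintype.card_pos
  have hMsq := card_edgeSet_le_sq n
  set M : ℝ := (Fintype.card (EdgeSet n) : ℝ) with hM
  have hM1 : 1 ≤ M := Nat.one_le_cast.mpr hMcard
  have hn1' : (1 : ℝ) ≤ n := Nat.one_le_cast.mpr hn1
  have hnK' : (K : ℝ) ≤ n := Nat.cast_le.mpr hnK
  obtain ⟨ρ, hρ⟩ : ∃ ρ, ρ = Real.exp (-(c / (2 * M))) := ⟨_, rfl⟩
  have hρT : Real.exp (-(c * n)) ≤ ρ ^ ((K + n) * Fintype.card (EdgeSet n)) := by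
    rw [hρ, ← Real.exp_nat_mul, Real.exp_le_exp]
    push_cast
    rw [← hM, show ((K : ℝ) + n) * M * -(c / (2 * M)) = -(c * ((K + n) / 2)) by
      field_simp]
    exact neg_le_neg (mul_le_mul_of_nonneg_left (by linarith) hc.le)
  have hpos : 0 ≤ ∑ x, ergmProb V G β x * f x ^ 2 := Finset.sum_nonneg fun x _ =>
    mul_nonneg (isReversible_ergm.nonneg x) (sq_nonneg _)
  have hρ1 : ρ ≤ 1 := by
    rw [hρ, Real.exp_le_one_iff]; exact neg_nonpos.mpr (by positivity)
  have hP := (isReversible_ergm (V := V) (G := G) (β := β) (n := n)).poincare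
    (T := (K + n) * Fintype.card (EdgeSet n))
    (Nat.mul_pos (by omega) hMcard) (hρ ▸ Real.exp_pos _) hρ1
    (fun g D hg x y => (abs_glauber_pow_sub_le_of_monotone ergmRate_nonneg ergmRate_le_one
      (ergmRate_monotone hβ) _ (hn.trans hρT) g D hg x y)) hf
  refine le_trans (mul_le_mul_of_nonneg_right ?_ hpos) hP
  have h1 : ρ ≤ 1 / (1 + c / (2 * M)) := by
    rw [hρ, Real.exp_neg, ← one_div]
    exact one_div_le_one_div_of_le (by positivity)
      (by linarith [Real.add_one_le_exp (c / (2 * M))])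
  have h2 : c / (2 + c) / (n : ℝ) ^ 2 ≤ 1 - 1 / (1 + c / (2 * M)) := by
    rw [show 1 - 1 / (1 + c / (2 * M)) = c / (2 * M + c) by field_simp; ring, div_div]
    exact div_le_div_of_nonneg_left hc.le (by positivity) (by nlinarith)
  rw [mul_div_assoc]
  linarith

end Gap

section TestFunction

variable {s : ℕ} {V : Fin s → ℕ} {G : ∀ i, SimpleGraph (Fin (V i))} {β : Fin s → ℝ} {n : ℕ}

theorem edgeX_update_not (e f : EdgeSet n) (x : Config n) :
    edgeX e (Function.update x f (!(x f))) = if f = e then 1 - edgeX e x else edgeX e x := by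
  by_cases hfe : f = e
  · subst hfe
    cases hx : x f <;> simp [edgeX, hx]
  · simp [edgeX, Function.update_of_ne (Ne.symm hfe), hfe]

theorem flipRate_mem_Icc (x : Config n) (e : EdgeSet n) : flipRate V G β x e ∈ Set.Icc 0 1 := by
  have h0 := Phi_pos (dHam V G β e x)
  have h1 := Phi_lt_one (dHam V G β e x)
  unfold flipRate
  split_ifs
  · exact ⟨by linarith, by linarith⟩
  · exact ⟨h0.le, h1.le⟩

theorem dirichlet_nonneg (f : Config n → ℝ) : 0 ≤ dirichlet V G β f :=
  mul_nonneg (by positivity) (Finset.sum_nonneg fun x _ => Finset.sum_nonneg fun e _ =>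
    mul_nonneg (mul_nonneg (flipRate_mem_Icc x e).1 (sq_nonneg _)) (isReversible_ergm.nonneg x))

theorem dirichlet_sub_div (f : Config n → ℝ) (a r : ℝ) :
    dirichlet V G β (fun x => (f x - a) / r) = dirichlet V G β f / r ^ 2 := by
  have h : ∀ x (e : EdgeSet n), flipRate V G β x e *
      ((f (Function.update x e (!(x e))) - a) / r - (f x - a) / r) ^ 2 * ergmProb V G β x =
      flipRate V G β x e * (f (Function.update x e (!(x e))) - f x) ^ 2 * ergmProb V G β x /
        r ^ 2 := fun x e => by
    rw [← sub_div, sub_sub_sub_cancel_right, div_pow]; ring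
  simp only [dirichlet, h, ← Finset.sum_div]
  rw [mul_div_assoc]

theorem dirichlet_edgeX_le (e : EdgeSet n) :
    dirichlet V G β (edgeX e) ≤ (Fintype.card (EdgeSet n) : ℝ)⁻¹ := by
  refine mul_le_of_le_one_right (by positivity) ?_
  refine le_trans (Finset.sum_le_sum fun x _ => ?_)
    (isReversible_ergm (V := V) (G := G) (β := β)).sum_eq_one.le
  rw [Finset.sum_eq_single_of_mem e (Finset.mem_univ e) fun f _ hfe => by
    rw [edgeX_update_not, if_neg hfe]; ring]
  refine mul_le_of_le_one_left (isReversible_ergm.nonneg x) ?_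
  have h1 : (edgeX e (Function.update x e (!(x e))) - edgeX e x) ^ 2 = 1 := by
    rw [edgeX_update_not, if_pos rfl]
    unfold edgeX
    split_ifs <;> norm_num
  rw [h1, mul_one]
  exact (flipRate_mem_Icc x e).2

/-- The single-edge consistency equation `π(x_e = 1) = 𝔼 Φ(∂_e H)`. -/
theorem expect_edgeX (e : EdgeSet n) :
    expect (ergmProb V G β) (edgeX e) = expect (ergmProb V G β) (ergmRate V G β n e) := by
  have hrev := isReversible_ergm (V := V) (G := G) (β := β) (n := n)
  have h1 : ∑ x, ergmProb V G β x * flipWeight (ergmRate V G β n) x e * edgeX e x =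
      ∑ x, ergmProb V G β x * flipWeight (ergmRate V G β n) x e * (1 - edgeX e x) := by
    rw [← sum_update_not e]
    refine Finset.sum_congr rfl fun x _ => ?_
    rw [← hrev.balance x e, edgeX_update_not, if_pos rfl]
  rw [← sub_eq_zero, ← Finset.sum_sub_distrib] at h1
  rw [← sub_eq_zero, expect, expect, ← Finset.sum_sub_distrib, ← h1]
  refine Finset.sum_congr rfl fun x _ => ?_
  unfold flipWeight edgeX
  split_ifs <;> ring

theorem expect_edgeX_mem_Icc (hβ : ∀ i, 0 ≤ β i) (e : EdgeSet n) :
    expect (ergmProb V G β) (edgeX e) ∈ Set.Icc (Phi 0) (Phi (Psi V G β 1)) := by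
  have hrev := isReversible_ergm (V := V) (G := G) (β := β) (n := n)
  rw [expect_edgeX]
  constructor
  · calc Phi 0 = ∑ x, ergmProb V G β x * Phi 0 := by
          rw [← Finset.sum_mul, hrev.sum_eq_one, one_mul]
      _ ≤ _ := Finset.sum_le_sum fun x _ => mul_le_mul_of_nonneg_left
          (Phi_monotone (dHam_nonneg hβ e x)) (hrev.nonneg x)
  · calc _ ≤ ∑ x, ergmProb V G β x * Phi (Psi V G β 1) :=
          Finset.sum_le_sum fun x _ => mul_le_mul_of_nonneg_left
            (Phi_monotone (dHam_le hβ e x)) (hrev.nonneg x)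
      _ = _ := by rw [← Finset.sum_mul, hrev.sum_eq_one, one_mul]

theorem expect_sub_div (f : Config n → ℝ) (r : ℝ) :
    expect (ergmProb V G β) (fun x => (f x - expect (ergmProb V G β) f) / r) = 0 := by
  have hrev := isReversible_ergm (V := V) (G := G) (β := β) (n := n)
  obtain ⟨m, hm⟩ : ∃ m, m = expect (ergmProb V G β) f := ⟨_, rfl⟩
  rw [← hm]
  simp only [expect, mul_div_assoc', mul_sub, ← Finset.sum_div, Finset.sum_sub_distrib,
    ← Finset.sum_mul, hrev.sum_eq_one]
  rw [one_mul, hm, expect, sub_self, zero_div]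

theorem variance_edgeX (e : EdgeSet n) :
    variance (ergmProb V G β) (edgeX e) =
      expect (ergmProb V G β) (edgeX e) * (1 - expect (ergmProb V G β) (edgeX e)) := by
  have hrev := isReversible_ergm (V := V) (G := G) (β := β) (n := n)
  obtain ⟨q, hq⟩ : ∃ q, q = expect (ergmProb V G β) (edgeX e) := ⟨_, rfl⟩
  rw [variance, ← hq, expect]
  have h : ∀ x : Config n, ergmProb V G β x * (edgeX e x - q) ^ 2 =
      ergmProb V G β x * edgeX e x * (1 - 2 * q) + ergmProb V G β x * q ^ 2 := fun x => by
    have : edgeX e x ^ 2 = edgeX e x := by unfold edgeX; split_ifs <;> norm_num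
    linear_combination ergmProb V G β x * this
  simp only [h, Finset.sum_add_distrib, ← Finset.sum_mul, hrev.sum_eq_one]
  rw [show ∑ x, ergmProb V G β x * edgeX e x = q by rw [hq, expect]]
  ring

/-- The normalised indicator of an edge is a test function for the spectral gap. -/
theorem exists_test_function (hβ : ∀ i, 0 ≤ β i) (e : EdgeSet n) :
    ∃ f : Config n → ℝ, expect (ergmProb V G β) f = 0 ∧
      expect (ergmProb V G β) (fun x => f x ^ 2) = 1 ∧
      dirichlet V G β f ≤
        (Fintype.card (EdgeSet n) : ℝ)⁻¹ / (Phi 0 * (1 - Phi (Psi V G β 1))) := by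
  have hq := expect_edgeX_mem_Icc (V := V) (G := G) hβ e
  have hv := variance_edgeX (V := V) (G := G) (β := β) e
  have h0 := Phi_pos 0
  have h1 := sub_pos.mpr (Phi_lt_one (Psi V G β 1))
  have hvle : Phi 0 * (1 - Phi (Psi V G β 1)) ≤ variance (ergmProb V G β) (edgeX e) := by
    rw [hv]
    exact mul_le_mul hq.1 (by linarith [hq.2]) h1.le (h0.le.trans hq.1)
  have hv0 := (mul_pos h0 h1).trans_le hvle
  refine ⟨fun x => (edgeX e x - expect (ergmProb V G β) (edgeX e)) /
    √(variance (ergmProb V G β) (edgeX e)), expect_sub_div _ _, ?_, ?_⟩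
  · simp only [div_pow, Real.sq_sqrt hv0.le, expect, mul_div_assoc', ← Finset.sum_div]
    exact div_self hv0.ne'
  · rw [dirichlet_sub_div, Real.sq_sqrt hv0.le]
    exact div_le_div₀ (by positivity) (dirichlet_edgeX_le e) (mul_pos h0 h1) hvle

theorem sq_le_four_mul_card_edgeSet (hn : 2 ≤ n) :
    (n : ℝ) ^ 2 ≤ 4 * Fintype.card (EdgeSet n) := by
  have h := two_mul_card_edgeSet n
  obtain ⟨k, rfl⟩ : ∃ k, n = k + 2 := ⟨n - 2, by omega⟩
  have h2 : (k + 2) ^ 2 ≤ 4 * Fintype.card (EdgeSet (k + 2)) := by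
    rw [show 4 * Fintype.card (EdgeSet (k + 2)) = 2 * (2 * Fintype.card (EdgeSet (k + 2))) by ring,
      h, Nat.add_sub_assoc (by norm_num)]
    norm_num
    nlinarith
  exact_mod_cast h2

end TestFunction

/-- **Theorem (spectral gap of order `n⁻²` and Poincaré inequality).**
If `β` is sub-critical, there are constants `c, C > 0` (depending only on `β` and the
graphs `G_i`) such that for all sufficiently large `n`, `c n⁻² ≤ γ ≤ C n⁻²`, and the
Poincaré inequality `Var_π(f) ≤ C n² ℰ(f,f)` holds for every `f : 𝒢_n → ℝ`. -/
theorem spectral_gap_order {s : ℕ} (V : Fin s → ℕ) (G : ∀ i, SimpleGraph (Fin (V i)))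
    (β : Fin s → ℝ) (hβ : ∀ i, 0 < β i) (p : ℝ) (hsub : Subcritical V G β p) :
    ∃ c C : ℝ, 0 < c ∧ 0 < C ∧ ∃ N : ℕ, ∀ n : ℕ, N ≤ n →
      (c / (n : ℝ) ^ 2 ≤ specGap n V G β ∧ specGap n V G β ≤ C / (n : ℝ) ^ 2) ∧
      ∀ f : Config n → ℝ,
        variance (ergmProb V G β) f ≤ C * (n : ℝ) ^ 2 * dirichlet V G β f := by
  have hβ' : ∀ i, 0 ≤ β i := fun i => (hβ i).le
  obtain ⟨c, hc, hgap⟩ := hsub.exists_poincare hβ'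
  obtain ⟨v, hv⟩ : ∃ v, v = Phi 0 * (1 - Phi (Psi V G β 1)) := ⟨_, rfl⟩
  have hv0 : 0 < v := hv ▸ mul_pos (Phi_pos 0) (sub_pos.mpr (Phi_lt_one _))
  obtain ⟨N, hN⟩ := eventually_atTop.mp (hgap.and (eventually_ge_atTop 2))
  refine ⟨c, max (4 / v) (1 / c), hc, lt_max_of_lt_left (by positivity), N, fun n hn => ?_⟩
  obtain ⟨hP, hn2⟩ := hN n hn
  have hn0 : (0 : ℝ) < (n : ℝ) ^ 2 := pow_pos (Nat.cast_pos.mpr (by omega)) 2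
  obtain ⟨e⟩ : Nonempty (EdgeSet n) := by
    rw [← Fintype.card_pos_iff, card_edgeSet]; exact Nat.choose_pos hn2
  obtain ⟨g, hg0, hg1, hg⟩ := exists_test_function (V := V) (G := G) hβ' e
  refine ⟨⟨?_, ?_⟩, fun f => ?_⟩
  · refine le_csInf ⟨_, g, hg0, hg1, rfl⟩ ?_
    rintro _ ⟨f, hf0, hf1, rfl⟩
    have := hP f hf0
    rwa [hf1, mul_one] at this
  · have hle : specGap n V G β ≤ dirichlet V G β g := by
      refine csInf_le ⟨0, ?_⟩ ⟨g, hg0, hg1, rfl⟩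
      rintro _ ⟨f, _, _, rfl⟩
      exact dirichlet_nonneg f
    refine hle.trans (hg.trans ?_)
    have hM := sq_le_four_mul_card_edgeSet hn2
    have hM0 : (0 : ℝ) < Fintype.card (EdgeSet n) := by linarith
    rw [← hv]
    refine le_trans ?_ (div_le_div_of_nonneg_right (le_max_left _ _) hn0.le)
    rw [inv_eq_one_div, div_div, div_div, div_le_div_iff₀ (by positivity) (by positivity)]
    nlinarith
  · have h1 := hP _ (expect_sub_div f 1)
    rw [dirichlet_sub_div] at h1
    simp only [div_one, one_pow] at h1
    have h2 : variance (ergmProb V G β) f ≤ 1 / c * (n : ℝ) ^ 2 * dirichlet V G β f := by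
      rw [show 1 / c * (n : ℝ) ^ 2 * dirichlet V G β f =
        dirichlet V G β f / (c / (n : ℝ) ^ 2) by field_simp, le_div_iff₀ (by positivity)]
      rw [variance]
      linarith
    refine h2.trans (mul_le_mul_of_nonneg_right ?_ (dirichlet_nonneg f))
    exact mul_le_mul_of_nonneg_right (le_max_right _ _) hn0.le

end ERGM
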